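/- Let K ≥ 1 be an integer. For all sufficiently large N, the number of primes p with N ≤ p ≤ (1 + 1/K)·N such that |k·p ± j·a^i| is not prime for all integers 1 ≤ a, j, k ≤ K and all integers 1 ≤ i ≤ K·log N, is at least c_K · N / log N for some constant c_K > 0 depending only on K. -/

import Mathlib

section

open Finset

theorem sum_powerset_interval_neg_one_pow {α : Type*} [DecidableEq α] {E F P : Finset α}
    (hF : F ⊆ P) :
    ∑ T ∈ P.powerset with E ⊆ T ∧ T ⊆ F, (-1 : ℝ) ^ #T = if E = F then (-1) ^ #E else 0 := by
  by_cases hEF : E ⊆ F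
  · have h1 : ∑ T ∈ P.powerset with E ⊆ T ∧ T ⊆ F, (-1 : ℝ) ^ #T =
        ∑ U ∈ (F \ E).powerset, (-1 : ℝ) ^ #(E ∪ U) := by
      symm
      refine Finset.sum_bij' (fun U _ => E ∪ U) (fun T _ => T \ E) ?_ ?_ ?_ ?_ ?_
      · intro U hU
        simp only [mem_powerset, mem_filter] at *
        have : E ∪ U ⊆ F := union_subset hEF (hU.trans sdiff_subset)
        exact ⟨this.trans hF, subset_union_left, this⟩
      · intro T hT
        simp only [mem_powerset, mem_filter] at *
        exact sdiff_subset_sdiff hT.2.2 le_rfl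
      · intro U hU
        simp only [mem_powerset] at hU
        ext x
        have := @hU x
        simp only [mem_sdiff, mem_union] at *
        tauto
      · intro T hT
        simp only [mem_powerset, mem_filter] at hT
        exact union_sdiff_of_subset hT.2.1
      · intro U hU
        rfl
    rw [h1]
    have h2 : ∀ U ∈ (F \ E).powerset, (-1 : ℝ) ^ #(E ∪ U) = (-1) ^ #E * (-1) ^ #U := by
      intro U hU
      rw [card_union_of_disjoint, pow_add]
      exact disjoint_of_subset_right (mem_powerset.1 hU) disjoint_sdiff
    rw [Finset.sum_congr rfl h2, ← Finset.mul_sum]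
    have h3 : ∑ U ∈ (F \ E).powerset, (-1 : ℝ) ^ #U = if F \ E = ∅ then 1 else 0 := by
      have := Finset.sum_powerset_neg_one_pow_card (x := F \ E)
      exact_mod_cast congrArg (Int.cast : ℤ → ℝ) this
    rw [h3]
    by_cases h : E = F
    · simp [h]
    · have : F \ E ≠ ∅ := fun h' => h (Subset.antisymm hEF (sdiff_eq_empty_iff_subset.1 h'))
      simp [h, this]
  · rw [if_neg (fun h => hEF h.le), Finset.sum_eq_zero]
    intro T hT
    simp only [mem_filter] at hT
    exact absurd (hT.2.1.trans hT.2.2) hEF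

/-- Selberg's `Λ²` upper bound sieve, for weights indexed by a family `D` of sets of sifting
indices which is closed under passing to subsets. -/
theorem selberg_sieve_upper_bound {ι α : Type*} [DecidableEq α] (I : Finset ι)
    (P : Finset α) (bad : ι → Finset α) (g : α → ℝ) (hg0 : ∀ l ∈ P, 0 < g l)
    (hg1 : ∀ l ∈ P, g l < 1) (D : Finset (Finset α)) (hDP : ∀ T ∈ D, T ⊆ P)
    (hempty : ∅ ∈ D) (hD : ∀ T ∈ D, ∀ U ⊆ T, U ∈ D) (X R : ℝ)
    (hR : ∀ T ∈ D, ∀ U ∈ D,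
      |(#{m ∈ I | T ∪ U ⊆ bad m} : ℝ) - X * ∏ l ∈ T ∪ U, g l| ≤ R) :
    (#{m ∈ I | Disjoint P (bad m)} : ℝ) ≤
      X / (∑ T ∈ D, ∏ l ∈ T, g l / (1 - g l)) + R * (∑ T ∈ D, (∏ l ∈ T, g l)⁻¹) ^ 2 := by
  classical
  set h : Finset α → ℝ := fun T => ∏ l ∈ T, g l / (1 - g l) with hh
  set G : Finset α → ℝ := fun T => ∏ l ∈ T, g l with hG
  set S : ℝ := ∑ T ∈ D, h T with hS
  have hhpos : ∀ T ∈ D, 0 < h T := fun T hT => Finset.prod_pos fun l hl =>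
    div_pos (hg0 l (hDP T hT hl)) (sub_pos.2 (hg1 l (hDP T hT hl)))
  have hGpos : ∀ T ∈ D, 0 < G T := fun T hT => Finset.prod_pos fun l hl =>
    hg0 l (hDP T hT hl)
  have hSpos : 0 < S := Finset.sum_pos hhpos ⟨∅, hempty⟩
  set lam : Finset α → ℝ := fun T => (-1) ^ #T / (G T * S) * ∑ F ∈ D with T ⊆ F, h F with hlam
  have hlam_empty : lam ∅ = 1 := by
    simp only [hlam, card_empty, pow_zero, hG, prod_empty, one_mul, empty_subset, filter_true]
    exact div_mul_cancel₀ 1 hSpos.ne'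
  have hlam_abs : ∀ T ∈ D, |lam T| ≤ (G T)⁻¹ := by
    intro T hT
    have h1 : ∑ F ∈ D with T ⊆ F, h F ≤ S :=
      Finset.sum_le_sum_of_subset_of_nonneg (filter_subset _ _) fun F hF _ => (hhpos F hF).le
    have h0 : 0 ≤ ∑ F ∈ D with T ⊆ F, h F :=
      Finset.sum_nonneg fun F hF => (hhpos F (mem_filter.1 hF).1).le
    have hGT := hGpos T hT
    rw [hlam]
    simp only [abs_mul, abs_div, abs_pow, abs_neg, abs_one, one_pow, abs_of_pos hGT,
      abs_of_pos hSpos, abs_of_nonneg h0]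
    rw [div_mul_eq_mul_div, one_mul, div_le_iff₀ (by positivity)]
    calc _ ≤ S := h1
      _ = _ := by field_simp
  have hy : ∀ E ∈ D, ∑ T ∈ D with E ⊆ T, G T * lam T = (-1) ^ #E * h E / S := by
    intro E hE
    have h1 : ∀ T ∈ D.filter (E ⊆ ·), G T * lam T =
        S⁻¹ * ∑ F ∈ D, if T ⊆ F then h F * (-1) ^ #T else 0 := by
      intro T hT
      have hGT := hGpos T (mem_filter.1 hT).1
      rw [← Finset.sum_filter, ← Finset.sum_mul, hlam]
      field_simp
    rw [Finset.sum_congr rfl h1, ← Finset.mul_sum, Finset.sum_comm]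
    have h2 : ∀ F ∈ D, (∑ T ∈ D with E ⊆ T, if T ⊆ F then h F * (-1) ^ #T else 0) =
        if E = F then h F * (-1) ^ #E else 0 := by
      intro F hF
      rw [← Finset.sum_filter, ← Finset.mul_sum, Finset.filter_filter]
      have : D.filter (fun T => E ⊆ T ∧ T ⊆ F) =
          P.powerset.filter (fun T => E ⊆ T ∧ T ⊆ F) := by
        ext T
        simp only [mem_filter, mem_powerset]
        exact ⟨fun ⟨a, b⟩ => ⟨hDP T a, b⟩, fun ⟨a, b⟩ => ⟨hD F hF T b.2, b⟩⟩
      rw [this, sum_powerset_interval_neg_one_pow (hDP F hF)]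
      simp
    rw [Finset.sum_congr rfl h2, Finset.sum_ite_eq, if_pos hE]
    ring
  have hunion : ∀ T ∈ D, ∀ U ∈ D, G (T ∪ U) =
      ∑ E ∈ D, if E ⊆ T ∧ E ⊆ U then G T * G U * (h E)⁻¹ else 0 := by
    intro T hT U hU
    rw [← Finset.sum_filter, ← Finset.mul_sum]
    have h1 : D.filter (fun E => E ⊆ T ∧ E ⊆ U) = (T ∩ U).powerset := by
      ext E
      simp only [mem_filter, mem_powerset, subset_inter_iff]
      exact ⟨fun a => a.2, fun a => ⟨hD T hT E a.1, a⟩⟩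
    rw [h1]
    have h2 : ∑ E ∈ (T ∩ U).powerset, (h E)⁻¹ = ∏ l ∈ T ∩ U, (1 + (1 - g l) / g l) := by
      rw [Finset.prod_one_add]
      refine Finset.sum_congr rfl fun E _ => ?_
      rw [hh]
      simp [Finset.prod_div_distrib]
    have h3 : ∏ l ∈ T ∩ U, (1 + (1 - g l) / g l) = (G (T ∩ U))⁻¹ := by
      rw [hG]
      simp only
      rw [← Finset.prod_inv_distrib]
      refine Finset.prod_congr rfl fun l hl => ?_
      have := hg0 l (hDP T hT (mem_inter.1 hl).1)
      field_simp
      ring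
    rw [h2, h3, ← div_eq_mul_inv, eq_div_iff]
    · exact Finset.prod_union_inter
    · exact (hGpos _ (hD T hT _ inter_subset_left)).ne'
  have hmain : ∑ T ∈ D, ∑ U ∈ D, lam T * lam U * G (T ∪ U) = 1 / S := by
    have h1 : ∀ T ∈ D, ∀ U ∈ D, lam T * lam U * G (T ∪ U) =
        ∑ E ∈ D, (h E)⁻¹ * ((if E ⊆ T then G T * lam T else 0) *
          (if E ⊆ U then G U * lam U else 0)) := by
      intro T hT U hU
      rw [hunion T hT U hU, Finset.mul_sum]
      refine Finset.sum_congr rfl fun E _ => ?_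
      by_cases a : E ⊆ T <;> by_cases b : E ⊆ U <;> simp [a, b] <;> ring
    calc _ = ∑ E ∈ D, (h E)⁻¹ * (∑ T ∈ D with E ⊆ T, G T * lam T) ^ 2 := by
          rw [Finset.sum_congr rfl fun T hT => Finset.sum_congr rfl (h1 T hT)]
          rw [Finset.sum_congr rfl fun T _ => Finset.sum_comm, Finset.sum_comm]
          refine Finset.sum_congr rfl fun E _ => ?_
          rw [sq, Finset.sum_filter, Finset.sum_mul_sum, Finset.mul_sum]
          refine Finset.sum_congr rfl fun T _ => ?_
          rw [Finset.mul_sum]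
      _ = ∑ E ∈ D, h E / S ^ 2 := by
          refine Finset.sum_congr rfl fun E hE => ?_
          rw [hy E hE]
          have := hhpos E hE
          have h1 : (((-1 : ℝ) ^ #E)) ^ 2 = 1 := by rw [← pow_mul, mul_comm, pow_mul]; simp
          rw [div_pow, mul_pow, h1]
          field_simp
      _ = 1 / S := by
          rw [← Finset.sum_div]
          field_simp
          rfl
  have hsq : (#{m ∈ I | Disjoint P (bad m)} : ℝ) ≤
      ∑ m ∈ I, (∑ T ∈ D with T ⊆ bad m, lam T) ^ 2 := by
    rw [Finset.card_filter, Nat.cast_sum]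
    refine Finset.sum_le_sum fun m _ => ?_
    by_cases hm : Disjoint P (bad m)
    · have : D.filter (· ⊆ bad m) = {∅} := by
        ext T
        simp only [mem_filter, mem_singleton]
        refine ⟨fun hT => ?_, fun hT => hT ▸ ⟨hempty, empty_subset _⟩⟩
        exact subset_empty.1 (Finset.disjoint_iff_inter_eq_empty.1 hm ▸
          subset_inter (hDP T hT.1) hT.2)
      simp [hm, this, hlam_empty]
    · simp only [hm, if_false, Nat.cast_zero]
      positivity
  have hexp : ∑ m ∈ I, (∑ T ∈ D with T ⊆ bad m, lam T) ^ 2 =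
      ∑ T ∈ D, ∑ U ∈ D, lam T * lam U * #{m ∈ I | T ∪ U ⊆ bad m} := by
    have h1 : ∀ m ∈ I, (∑ T ∈ D with T ⊆ bad m, lam T) ^ 2 =
        ∑ T ∈ D, ∑ U ∈ D, if T ∪ U ⊆ bad m then lam T * lam U else 0 := by
      intro m _
      rw [sq, Finset.sum_filter, Finset.sum_mul_sum]
      refine Finset.sum_congr rfl fun T _ => Finset.sum_congr rfl fun U _ => ?_
      by_cases a : T ⊆ bad m <;> by_cases b : U ⊆ bad m <;> simp [a, b, union_subset_iff]
    rw [Finset.sum_congr rfl h1, Finset.sum_comm]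
    refine Finset.sum_congr rfl fun T _ => ?_
    rw [Finset.sum_comm]
    refine Finset.sum_congr rfl fun U _ => ?_
    rw [← Finset.sum_filter, Finset.sum_const, nsmul_eq_mul, mul_comm]
  have hbound : ∑ T ∈ D, ∑ U ∈ D, lam T * lam U * #{m ∈ I | T ∪ U ⊆ bad m} ≤
      ∑ T ∈ D, ∑ U ∈ D, (X * (lam T * lam U * G (T ∪ U)) + R * ((G T)⁻¹ * (G U)⁻¹)) := by
    refine Finset.sum_le_sum fun T hT => Finset.sum_le_sum fun U hU => ?_
    have h1 := hR T hT U hU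
    have h2 : |lam T * lam U| ≤ (G T)⁻¹ * (G U)⁻¹ := by
      rw [abs_mul]
      exact mul_le_mul (hlam_abs T hT) (hlam_abs U hU) (abs_nonneg _)
        (inv_pos.2 (hGpos T hT)).le
    have h3 : lam T * lam U * ((#{m ∈ I | T ∪ U ⊆ bad m} : ℝ) - X * G (T ∪ U)) ≤
        R * ((G T)⁻¹ * (G U)⁻¹) := by
      refine (le_abs_self _).trans ?_
      rw [abs_mul, mul_comm]
      exact mul_le_mul h1 h2 (abs_nonneg _) ((abs_nonneg _).trans h1)
    linarith
  calc _ ≤ _ := hsq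
    _ = _ := hexp
    _ ≤ _ := hbound
    _ = _ := by
      simp only [Finset.sum_add_distrib, ← Finset.mul_sum, hmain]
      rw [sq, Finset.sum_mul_sum]
      simp only [← Finset.mul_sum]
      ring

theorem abs_card_modEq_sub_le {d : ℕ} (hd : 0 < d) (c M : ℕ) :
    |(#{m ∈ range M | m ≡ c [MOD d]} : ℝ) - M / d| ≤ 1 := by
  have h1 : #{m ∈ range M | m ≡ c [MOD d]} = M.count (· ≡ c [MOD d]) := by
    rw [Nat.count_eq_card_filter_range]
  rw [h1, Nat.count_modEq_card M hd]
  have h2 : (M : ℝ) = d * (M / d : ℕ) + (M % d : ℕ) := by exact_mod_cast (Nat.div_add_mod M d).symm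
  have h3 : ((M % d : ℕ) : ℝ) < d := by exact_mod_cast Nat.mod_lt M hd
  have hd' : (0 : ℝ) < d := by exact_mod_cast hd
  have h4 : (M : ℝ) / d = (M / d : ℕ) + (M % d : ℕ) / (d : ℝ) := by
    rw [div_eq_iff hd'.ne']; field_simp; linarith
  have h5 : ((M % d : ℕ) : ℝ) / d < 1 := (div_lt_one hd').2 h3
  have h6 : 0 ≤ ((M % d : ℕ) : ℝ) / d := by positivity
  rw [h4, abs_le]
  push_cast
  split_ifs <;> constructor <;> linarith

theorem modEq_prod_primes_iff {T : Finset ℕ} (hT : ∀ l ∈ T, l.Prime) (m c : ℕ) :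
    m ≡ c [MOD ∏ l ∈ T, l] ↔ ∀ l ∈ T, m ≡ c [MOD l] := by
  induction T using Finset.induction_on with
  | empty => simp [Nat.modEq_one]
  | insert p T hp ih =>
    have hcop : Nat.Coprime p (∏ l ∈ T, l) := Nat.Coprime.prod_right fun l hl =>
      (Nat.coprime_primes (hT p (mem_insert_self _ _)) (hT l (mem_insert_of_mem hl))).2
        fun h => hp (h ▸ hl)
    rw [prod_insert hp, ← Nat.modEq_and_modEq_iff_modEq_mul hcop,
      ih fun l hl => hT l (mem_insert_of_mem hl), forall_mem_insert]

theorem abs_card_forall_modEq_sub_le {T : Finset ℕ} (hT : ∀ l ∈ T, l.Prime) (c : ℕ → ℕ)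
    (M : ℕ) :
    |(#{m ∈ range M | ∀ l ∈ T, m ≡ c l [MOD l]} : ℝ) - M * ∏ l ∈ T, (l : ℝ)⁻¹| ≤ 1 := by
  have hpw : Set.Pairwise (T : Set ℕ) (fun i j => Nat.Coprime (id i) (id j)) := fun i hi j hj hij =>
    (Nat.coprime_primes (hT i hi) (hT j hj)).2 hij
  obtain ⟨c₀, hc₀⟩ := Nat.chineseRemainderOfFinset c id T (fun i hi => (hT i hi).ne_zero) hpw
  have h1 : {m ∈ range M | ∀ l ∈ T, m ≡ c l [MOD l]} =
      {m ∈ range M | m ≡ c₀ [MOD ∏ l ∈ T, l]} := by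
    refine filter_congr fun m _ => ?_
    rw [modEq_prod_primes_iff hT]
    exact ⟨fun h l hl => (h l hl).trans (hc₀ l hl).symm, fun h l hl => (h l hl).trans (hc₀ l hl)⟩
  rw [h1, prod_inv_distrib, ← div_eq_mul_inv, ← Nat.cast_prod]
  exact abs_card_modEq_sub_le (prod_pos fun l hl => (hT l hl).pos) c₀ M

/-- The number of `m < M` lying in one of two prescribed classes modulo every prime in `T`. -/
theorem abs_card_forall_modEq_or_modEq_sub_le {T : Finset ℕ} (hT : ∀ l ∈ T, l.Prime)
    (α β : ℕ → ℕ) (hαβ : ∀ l ∈ T, ¬ α l ≡ β l [MOD l]) (M : ℕ) :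
    |(#{m ∈ range M | ∀ l ∈ T, m ≡ α l [MOD l] ∨ m ≡ β l [MOD l]} : ℝ) -
      M * ∏ l ∈ T, 2 / (l : ℝ)| ≤ 2 ^ #T := by
  classical
  have h1 : (#{m ∈ range M | ∀ l ∈ T, m ≡ α l [MOD l] ∨ m ≡ β l [MOD l]} : ℝ) =
      ∑ U ∈ T.powerset,
        (#{m ∈ range M | ∀ l ∈ T, m ≡ (if l ∈ U then α l else β l) [MOD l]} : ℝ) := by
    simp only [card_filter, Nat.cast_sum, Nat.cast_ite, Nat.cast_one, Nat.cast_zero]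
    rw [sum_comm]
    refine sum_congr rfl fun m _ => ?_
    have h2 : (if ∀ l ∈ T, m ≡ α l [MOD l] ∨ m ≡ β l [MOD l] then (1 : ℝ) else 0) =
        ∏ l ∈ T, ((if m ≡ α l [MOD l] then (1 : ℝ) else 0) +
          (if m ≡ β l [MOD l] then (1 : ℝ) else 0)) := by
      rw [← prod_boole]
      refine prod_congr rfl fun l hl => ?_
      by_cases a : m ≡ α l [MOD l] <;> by_cases b : m ≡ β l [MOD l] <;> simp [a, b]
      exact hαβ l hl (a.symm.trans b)
    rw [h2, prod_add]
    refine sum_congr rfl fun U hU => ?_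
    rw [← prod_boole, ← prod_sdiff (mem_powerset.1 hU), mul_comm]
    congr 1
    · exact prod_congr rfl fun l hl => by simp [(mem_sdiff.1 hl).2]
    · exact prod_congr rfl fun l hl => by simp [hl]
  have h3 : (M : ℝ) * ∏ l ∈ T, 2 / (l : ℝ) =
      ∑ U ∈ T.powerset, M * ∏ l ∈ T, (l : ℝ)⁻¹ := by
    simp only [div_eq_mul_inv, prod_mul_distrib, prod_const, sum_const, card_powerset,
      nsmul_eq_mul, Nat.cast_pow, Nat.cast_ofNat]
    ring
  rw [h1, h3, ← sum_sub_distrib]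
  calc _ ≤ ∑ U ∈ T.powerset, |(#{m ∈ range M | ∀ l ∈ T,
            m ≡ (if l ∈ U then α l else β l) [MOD l]} : ℝ) - M * ∏ l ∈ T, (l : ℝ)⁻¹| :=
        abs_sum_le_sum_abs _ _
    _ ≤ ∑ U ∈ T.powerset, 1 :=
        sum_le_sum fun U _ => abs_card_forall_modEq_sub_le hT (fun l => if l ∈ U then α l else β l) M
    _ = _ := by simp

theorem sum_inv_le_prod_of_factored (s : Finset ℕ) (hs : ∀ p ∈ s, p.Prime) (A : Finset ℕ)
    (hA : ∀ n ∈ A, n ∈ Nat.factoredNumbers s) :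
    ∑ n ∈ A, (n : ℝ)⁻¹ ≤ ∏ p ∈ s, (1 - (p : ℝ)⁻¹)⁻¹ := by
  let f : ℕ →* ℝ :=
    { toFun := fun n => (n : ℝ)⁻¹
      map_one' := by simp
      map_mul' := fun a b => by rw [Nat.cast_mul, mul_inv] }
  have h := (EulerProduct.summable_and_hasSum_factoredNumbers_prod_filter_prime_geometric
    (f := f) (fun {p} hp => by
      have : (1 : ℝ) < p := by exact_mod_cast hp.one_lt
      change ‖(p : ℝ)⁻¹‖ < 1
      rw [norm_inv, Real.norm_natCast]
      exact inv_lt_one_of_one_lt₀ this) s).2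
  rw [filter_true_of_mem hs] at h
  have h2 : ∑ n ∈ A, (n : ℝ)⁻¹ = ∑ x ∈ A.attach.map
      ⟨fun n : {x // x ∈ A} => (⟨n.1, hA n.1 n.2⟩ : Nat.factoredNumbers s), fun a b hab =>
        Subtype.ext (congrArg (fun x : Nat.factoredNumbers s => x.1) hab)⟩, f x := by
    rw [sum_map, ← sum_attach]
    rfl
  rw [h2]
  exact sum_le_hasSum _ (fun x _ => inv_nonneg.2 (Nat.cast_nonneg _)) h

theorem prod_primes_injOn : Set.InjOn (fun T : Finset ℕ => ∏ l ∈ T, l)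
    {T | ∀ l ∈ T, l.Prime} := by
  intro T hT U hU h
  have := congrArg Nat.primeFactors h
  simp only at this
  rwa [Nat.primeFactors_prod hT, Nat.primeFactors_prod hU] at this

theorem log_le_mul_sum_prod_inv_sub_one {Q : ℕ} (hQ : Q ≠ 0) (y : ℕ) (P : Finset ℕ)
    (hP : ∀ l, l ∈ P ↔ l.Prime ∧ l ≤ y ∧ ¬ l ∣ Q) :
    Real.log y ≤ (Q / Q.totient : ℝ) *
      ∑ U ∈ P.powerset with ∏ l ∈ U, l ≤ y, ∏ l ∈ U, ((l : ℝ) - 1)⁻¹ := by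
  classical
  have hφ : ∏ p ∈ Q.primeFactors, (1 - (p : ℝ)⁻¹)⁻¹ = (Q / Q.totient : ℝ) := by
    have h1 := Nat.totient_eq_mul_prod_factors Q
    have h2 : (Q.totient : ℝ) = Q * ∏ p ∈ Q.primeFactors, (1 - (p : ℝ)⁻¹) := by
      have := congrArg (Rat.cast : ℚ → ℝ) h1
      push_cast at this
      exact this
    have h3 : (Q.totient : ℝ) ≠ 0 := by
      exact_mod_cast (Nat.totient_pos.2 (Nat.pos_of_ne_zero hQ)).ne'
    have h4 : (Q : ℝ) ≠ 0 := by exact_mod_cast hQ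
    rw [prod_inv_distrib, eq_div_iff h3, h2]
    rw [h2] at h3
    have := right_ne_zero_of_mul h3
    rw [mul_comm (Q : ℝ), inv_mul_cancel_left₀ this]
  set F : ℕ → Finset ℕ := fun n => n.primeFactors.filter (fun l => ¬ l ∣ Q) with hF
  have hmaps : ∀ n ∈ Icc 1 y, F n ∈ P.powerset.filter (fun U => ∏ l ∈ U, l ≤ y) := by
    intro n hn
    rw [mem_Icc] at hn
    rw [mem_filter, mem_powerset]
    refine ⟨fun l hl => ?_, ?_⟩
    · rw [hF, mem_filter, Nat.mem_primeFactors] at hl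
      exact (hP l).2 ⟨hl.1.1, (Nat.le_of_dvd hn.1 hl.1.2.1).trans hn.2, hl.2⟩
    · have : ∏ l ∈ F n, l ∣ n :=
        (prod_dvd_prod_of_subset _ _ _ (filter_subset _ _)).trans (Nat.prod_primeFactors_dvd n)
      exact (Nat.le_of_dvd hn.1 this).trans hn.2
  calc Real.log y ≤ Real.log (y + 1 : ℕ) := by
        rcases Nat.eq_zero_or_pos y with rfl | hy
        · simp
        · exact Real.log_le_log (by exact_mod_cast hy) (by push_cast; linarith)
    _ ≤ ∑ n ∈ Icc 1 y, (n : ℝ)⁻¹ := by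
        have := log_add_one_le_harmonic y
        rw [harmonic_eq_sum_Icc] at this
        push_cast at this ⊢
        exact this
    _ = ∑ U ∈ P.powerset with ∏ l ∈ U, l ≤ y, ∑ n ∈ Icc 1 y with F n = U, (n : ℝ)⁻¹ :=
        (sum_fiberwise_of_maps_to hmaps _).symm
    _ ≤ ∑ U ∈ P.powerset with ∏ l ∈ U, l ≤ y,
          (Q / Q.totient : ℝ) * ∏ l ∈ U, ((l : ℝ) - 1)⁻¹ := by
        refine sum_le_sum fun U hU => ?_
        rw [mem_filter, mem_powerset] at hU
        have hUp : ∀ l ∈ U, l.Prime := fun l hl => ((hP l).1 (hU.1 hl)).1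
        have hUpos : 0 < ∏ l ∈ U, l := prod_pos fun l hl => (hUp l hl).pos
        have hdvd : ∀ n ∈ (Icc 1 y).filter (fun n => F n = U), ∏ l ∈ U, l ∣ n := by
          intro n hn
          rw [mem_filter] at hn
          rw [← hn.2]
          exact (prod_dvd_prod_of_subset _ _ _ (filter_subset _ _)).trans
            (Nat.prod_primeFactors_dvd n)
        have hdisj : Disjoint U Q.primeFactors := by
          rw [disjoint_left]
          exact fun l hl hl' => ((hP l).1 (hU.1 hl)).2.2 (Nat.dvd_of_mem_primeFactors hl')
        have h1 : ∑ n ∈ Icc 1 y with F n = U, (n : ℝ)⁻¹ =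
            (∏ l ∈ U, (l : ℝ))⁻¹ * ∑ v ∈ ((Icc 1 y).filter (fun n => F n = U)).image
              (fun n => n / ∏ l ∈ U, l), (v : ℝ)⁻¹ := by
          rw [sum_image, mul_sum]
          · refine sum_congr rfl fun n hn => ?_
            rw [Nat.cast_div (hdvd n hn) (by exact_mod_cast hUpos.ne'), Nat.cast_prod]
            have : (∏ l ∈ U, (l : ℝ)) ≠ 0 := by rw [← Nat.cast_prod]; exact_mod_cast hUpos.ne'
            field_simp
          · intro a ha b hb hab
            exact (Nat.div_left_inj (hdvd a ha) (hdvd b hb)).1 hab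
        have h2 : ∑ v ∈ ((Icc 1 y).filter (fun n => F n = U)).image
              (fun n => n / ∏ l ∈ U, l), (v : ℝ)⁻¹ ≤
            ∏ p ∈ U ∪ Q.primeFactors, (1 - (p : ℝ)⁻¹)⁻¹ := by
          apply sum_inv_le_prod_of_factored
          · intro p hp
            rcases mem_union.1 hp with hp | hp
            · exact hUp p hp
            · exact Nat.prime_of_mem_primeFactors hp
          · intro v hv
            obtain ⟨n, hn, rfl⟩ := mem_image.1 hv
            have hnd := hdvd n hn
            rw [mem_filter, mem_Icc] at hn
            refine Nat.mem_factoredNumbers_of_dvd (m := n) ?_ (Nat.div_dvd_of_dvd hnd)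
            refine Nat.mem_factoredNumbers_of_primeFactors_subset (by lia) fun p hp => ?_
            by_cases hpQ : p ∣ Q
            · exact mem_union_right _ (Nat.mem_primeFactors.2
                ⟨Nat.prime_of_mem_primeFactors hp, hpQ, hQ⟩)
            · exact mem_union_left _ (hn.2 ▸ mem_filter.2 ⟨hp, hpQ⟩)
        rw [prod_union hdisj, hφ] at h2
        have h3 : ∏ l ∈ U, ((l : ℝ) - 1)⁻¹ =
            (∏ l ∈ U, (l : ℝ))⁻¹ * ∏ p ∈ U, (1 - (p : ℝ)⁻¹)⁻¹ := by
          rw [← prod_inv_distrib, ← prod_mul_distrib]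
          refine prod_congr rfl fun l hl => ?_
          have : (0 : ℝ) < l := by exact_mod_cast (hUp l hl).pos
          rw [← mul_inv]
          congr 1
          field_simp
        rw [h1, h3]
        calc _ ≤ (∏ l ∈ U, (l : ℝ))⁻¹ *
              ((∏ p ∈ U, (1 - (p : ℝ)⁻¹)⁻¹) * (Q / Q.totient : ℝ)) := by gcongr
          _ = _ := by ring
    _ = _ := by rw [mul_sum]

theorem sq_sum_prod_le_sum_prod {α : Type*} [DecidableEq α] (A D : Finset (Finset α))
    (hAD : ∀ U ∈ A, ∀ V ∈ A, U ∪ V ∈ D) (a b : α → ℝ)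
    (ha : ∀ T ∈ D, ∀ l ∈ T, 0 ≤ a l) (hab : ∀ T ∈ D, ∀ l ∈ T, 2 * a l + a l ^ 2 ≤ b l) :
    (∑ U ∈ A, ∏ l ∈ U, a l) ^ 2 ≤ ∑ T ∈ D, ∏ l ∈ T, b l := by
  have h1 : (∑ U ∈ A, ∏ l ∈ U, a l) ^ 2 =
      ∑ p ∈ A ×ˢ A, (∏ l ∈ p.1, a l) * ∏ l ∈ p.2, a l := by
    rw [sq, sum_mul_sum, sum_product]
  rw [h1, ← sum_fiberwise_of_maps_to (t := D) (g := fun p : Finset α × Finset α => p.1 ∪ p.2)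
    (fun p hp => hAD _ (mem_product.1 hp).1 _ (mem_product.1 hp).2)]
  refine sum_le_sum fun T hT => ?_
  have haT := ha T hT
  have hprod : ∀ U ⊆ T, 0 ≤ ∏ l ∈ U, a l := fun U hU => prod_nonneg fun l hl => haT l (hU hl)
  have hfib : ∀ U ∈ T.powerset, ∑ V ∈ T.powerset with U ∪ V = T, ∏ l ∈ V, a l =
      (∏ l ∈ T \ U, a l) * ∏ l ∈ U, (1 + a l) := by
    intro U hU
    rw [mem_powerset] at hU
    rw [prod_one_add, mul_sum]
    refine sum_bij' (fun V _ => V ∩ U) (fun Y _ => (T \ U) ∪ Y) ?_ ?_ ?_ ?_ ?_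
    · exact fun V _ => mem_powerset.2 inter_subset_right
    · intro Y hY
      rw [mem_powerset] at hY
      rw [mem_filter, mem_powerset]
      refine ⟨union_subset sdiff_subset (hY.trans hU), ?_⟩
      rw [← union_assoc, union_sdiff_of_subset hU]
      exact union_eq_left.2 (hY.trans hU)
    · intro V hV
      rw [mem_filter, mem_powerset] at hV
      obtain ⟨hVT, rfl⟩ := hV
      ext x
      simp only [mem_union, mem_sdiff, mem_inter]
      tauto
    · intro Y hY
      rw [mem_powerset] at hY
      ext x
      have := @hY x
      simp only [mem_union, mem_sdiff, mem_inter]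
      tauto
    · intro V hV
      rw [mem_filter, mem_powerset] at hV
      obtain ⟨hVT, rfl⟩ := hV
      rw [← prod_union]
      · congr 1
        ext x
        simp only [mem_union, mem_sdiff, mem_inter]
        tauto
      · exact disjoint_of_subset_right inter_subset_right sdiff_disjoint
  calc ∑ p ∈ A ×ˢ A with p.1 ∪ p.2 = T, (∏ l ∈ p.1, a l) * ∏ l ∈ p.2, a l
      ≤ ∑ p ∈ T.powerset ×ˢ T.powerset with p.1 ∪ p.2 = T,
          (∏ l ∈ p.1, a l) * ∏ l ∈ p.2, a l := by
        refine sum_le_sum_of_subset_of_nonneg ?_ ?_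
        · intro p hp
          rw [mem_filter] at hp ⊢
          rw [mem_product, mem_powerset, mem_powerset]
          exact ⟨⟨hp.2 ▸ subset_union_left, hp.2 ▸ subset_union_right⟩, hp.2⟩
        · intro p hp _
          rw [mem_filter, mem_product, mem_powerset, mem_powerset] at hp
          exact mul_nonneg (hprod _ hp.1.1) (hprod _ hp.1.2)
    _ = ∑ U ∈ T.powerset, (∏ l ∈ U, a l * (1 + a l)) * ∏ l ∈ T \ U, a l := by
        rw [sum_filter, sum_product]
        refine sum_congr rfl fun U hU => ?_
        simp only
        rw [← sum_filter, ← mul_sum, hfib U hU, prod_mul_distrib]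
        ring
    _ = ∏ l ∈ T, (a l * (1 + a l) + a l) := (prod_add _ _ _).symm
    _ ≤ ∏ l ∈ T, b l := by
        refine prod_le_prod (fun l hl => ?_) fun l hl => ?_
        · have := haT l hl
          positivity
        · have := hab T hT l hl
          linarith

set_option maxHeartbeats 1000000 in
/-- An upper bound sieve of dimension two, of the correct order of magnitude: elements of `A` avoid
two distinct classes modulo every prime `l ≤ y ^ 2` not dividing `Q`. -/
theorem card_le_of_avoid_two_classes {Q : ℕ} (hQ : Q ≠ 0) (hQ2 : 2 ∣ Q) {y : ℕ} (hy : 2 ≤ y)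
    (M : ℕ) (α β : ℕ → ℕ) (hαβ : ∀ l : ℕ, l.Prime → ¬ l ∣ Q → ¬ α l ≡ β l [MOD l])
    (A : Finset ℕ) (hAM : A ⊆ range M)
    (hA : ∀ m ∈ A, ∀ l : ℕ, l.Prime → l ≤ y ^ 2 → ¬ l ∣ Q →
      ¬ m ≡ α l [MOD l] ∧ ¬ m ≡ β l [MOD l]) :
    (#A : ℝ) ≤ M * (Q / Q.totient : ℝ) ^ 2 / Real.log y ^ 2 + y ^ 12 := by
  classical
  set z := y ^ 2 with hz
  set P : Finset ℕ := (Icc 1 z).filter fun l => l.Prime ∧ ¬ l ∣ Q with hP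
  have hPmem : ∀ l, l ∈ P ↔ l.Prime ∧ l ≤ z ∧ ¬ l ∣ Q := fun l => by
    rw [hP, mem_filter, mem_Icc]
    exact ⟨fun h => ⟨h.2.1, h.1.2, h.2.2⟩, fun h => ⟨⟨h.1.one_lt.le, h.2.1⟩, h.1, h.2.2⟩⟩
  have hP3 : ∀ l ∈ P, (3 : ℝ) ≤ l := fun l hl => by
    have h1 := (hPmem l).1 hl
    have h2 : l ≠ 2 := fun h => h1.2.2 (h ▸ hQ2)
    have := h1.1.two_le
    exact_mod_cast (by lia : 3 ≤ l)
  have hPp : ∀ l ∈ P, l.Prime := fun l hl => ((hPmem l).1 hl).1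
  set D := P.powerset.filter (fun T => ∏ l ∈ T, l ≤ z) with hD
  have hDmem : ∀ T, T ∈ D ↔ T ⊆ P ∧ ∏ l ∈ T, l ≤ z := fun T => by
    rw [hD, mem_filter, mem_powerset]
  set bad : ℕ → Finset ℕ := fun m =>
    P.filter (fun l => m ≡ α l [MOD l] ∨ m ≡ β l [MOD l]) with hbad
  have hz1 : 1 ≤ z := Nat.one_le_pow _ _ (by lia)
  have hprodpos : ∀ T ⊆ P, 0 < ∏ l ∈ T, l := fun T hT => prod_pos fun l hl => (hPp l (hT hl)).pos
  have hsieve := selberg_sieve_upper_bound (range M) P bad (fun l => 2 / (l : ℝ))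
    (fun l hl => by have := hP3 l hl; positivity)
    (fun l hl => by have := hP3 l hl; rw [div_lt_one] <;> linarith)
    D (fun T hT => ((hDmem T).1 hT).1) ((hDmem _).2 (by simpa using hz1))
    (fun T hT U hU => by
      rw [hDmem] at hT ⊢
      refine ⟨hU.trans hT.1, le_trans ?_ hT.2⟩
      exact Nat.le_of_dvd (hprodpos T hT.1) (prod_dvd_prod_of_subset _ _ _ hU))
    M ((z : ℝ) ^ 2) (fun T hT U hU => by
      rw [hDmem] at hT hU
      have hTU : T ∪ U ⊆ P := union_subset hT.1 hU.1
      have h1 := abs_card_forall_modEq_or_modEq_sub_le (T := T ∪ U)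
        (fun l hl => hPp l (hTU hl)) α β
        (fun l hl => hαβ l (hPp l (hTU hl)) ((hPmem l).1 (hTU hl)).2.2) M
      have h2 : {m ∈ range M | T ∪ U ⊆ bad m} =
          {m ∈ range M | ∀ l ∈ T ∪ U, m ≡ α l [MOD l] ∨ m ≡ β l [MOD l]} := by
        refine filter_congr fun m _ => ?_
        refine ⟨fun h l hl => (mem_filter.1 (h hl)).2, fun h l hl => ?_⟩
        exact mem_filter.2 ⟨hTU hl, h l hl⟩
      rw [h2]
      refine h1.trans ?_
      have h3 : (2 : ℕ) ^ #(T ∪ U) ≤ z ^ 2 := by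
        calc 2 ^ #(T ∪ U) ≤ ∏ l ∈ T ∪ U, l :=
              pow_card_le_prod _ _ _ fun l hl => (hPp l (hTU hl)).two_le
          _ ≤ (∏ l ∈ T ∪ U, l) * ∏ l ∈ T ∩ U, l :=
              Nat.le_mul_of_pos_right _ (hprodpos _ (inter_subset_left.trans hT.1))
          _ = (∏ l ∈ T, l) * ∏ l ∈ U, l := prod_union_inter
          _ ≤ z * z := Nat.mul_le_mul hT.2 hU.2
          _ = z ^ 2 := (sq z).symm
      exact_mod_cast h3)
  have hAle : (#A : ℝ) ≤ #{m ∈ range M | Disjoint P (bad m)} := by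
    refine Nat.cast_le.2 (card_le_card fun m hm => mem_filter.2 ⟨hAM hm, ?_⟩)
    rw [disjoint_left]
    intro l hl hl'
    have h1 := (hPmem l).1 hl
    have h2 := hA m hm l h1.1 h1.2.1 h1.2.2
    rcases (mem_filter.1 hl').2 with h | h
    · exact h2.1 h
    · exact h2.2 h
  have hsum : ∑ T ∈ D, (∏ l ∈ T, 2 / (l : ℝ))⁻¹ ≤ (z : ℝ) ^ 2 := by
    calc ∑ T ∈ D, (∏ l ∈ T, 2 / (l : ℝ))⁻¹ ≤ ∑ T ∈ D, ((∏ l ∈ T, l : ℕ) : ℝ) := by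
          refine sum_le_sum fun T hT => ?_
          rw [← prod_inv_distrib, Nat.cast_prod]
          refine prod_le_prod (fun l _ => by positivity) fun l hl => ?_
          rw [inv_div]
          have := hP3 l (((hDmem T).1 hT).1 hl)
          linarith
      _ = ∑ n ∈ D.image (fun T => ∏ l ∈ T, l), (n : ℝ) := by
          rw [sum_image]
          intro T hT U hU h
          exact prod_primes_injOn (fun l hl => hPp l (((hDmem T).1 hT).1 hl))
            (fun l hl => hPp l (((hDmem U).1 hU).1 hl)) h
      _ ≤ ∑ n ∈ Icc 1 z, (n : ℝ) := by
          refine sum_le_sum_of_subset_of_nonneg ?_ fun _ _ _ => by positivity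
          intro n hn
          obtain ⟨T, hT, rfl⟩ := mem_image.1 hn
          have := (hDmem T).1 hT
          exact mem_Icc.2 ⟨hprodpos T this.1, this.2⟩
      _ ≤ ∑ n ∈ Icc 1 z, (z : ℝ) :=
          sum_le_sum fun n hn => by exact_mod_cast (mem_Icc.1 hn).2
      _ = _ := by simp [sq]
  set Py : Finset ℕ := P.filter (· ≤ y) with hPy
  have hyz : y ≤ z := by rw [hz, sq]; exact Nat.le_mul_of_pos_left _ (by lia)
  have hlog := log_le_mul_sum_prod_inv_sub_one hQ y Py (fun l => by
    rw [hPy, mem_filter, hPmem]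
    exact ⟨fun h => ⟨h.1.1, h.2, h.1.2.2⟩, fun h => ⟨⟨h.1, h.2.1.trans hyz, h.2.2⟩, h.2.1⟩⟩)
  have hS := sq_sum_prod_le_sum_prod (Py.powerset.filter (fun U => ∏ l ∈ U, l ≤ y)) D
    (fun U hU V hV => by
      rw [mem_filter, mem_powerset] at hU hV
      have hUP := hU.1.trans (filter_subset _ _)
      have hVP := hV.1.trans (filter_subset _ _)
      rw [hDmem]
      refine ⟨union_subset hUP hVP, ?_⟩
      calc ∏ l ∈ U ∪ V, l ≤ (∏ l ∈ U ∪ V, l) * ∏ l ∈ U ∩ V, l :=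
              Nat.le_mul_of_pos_right _ (hprodpos _ (inter_subset_left.trans hUP))
          _ = (∏ l ∈ U, l) * ∏ l ∈ V, l := prod_union_inter
          _ ≤ y * y := Nat.mul_le_mul hU.2 hV.2
          _ = z := (sq y).symm)
    (fun l => ((l : ℝ) - 1)⁻¹) (fun l => 2 / (l : ℝ) / (1 - 2 / (l : ℝ)))
    (fun T hT l hl => by
      have := hP3 l (((hDmem T).1 hT).1 hl)
      exact inv_nonneg.2 (by linarith))
    (fun T hT l hl => by
      have := hP3 l (((hDmem T).1 hT).1 hl)
      have h1 : (0 : ℝ) < l - 2 := by linarith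
      have h2 : (0 : ℝ) < l - 1 := by linarith
      have h3 : 2 / (l : ℝ) / (1 - 2 / (l : ℝ)) = 2 / (l - 2) := by field_simp
      have h4 : 2 * ((l : ℝ) - 1)⁻¹ + ((l : ℝ) - 1)⁻¹ ^ 2 = (2 * l - 1) / (l - 1) ^ 2 := by
        field_simp
        ring
      rw [h3, h4, div_le_div_iff₀ (by positivity) h1]
      nlinarith)
  set S := ∑ T ∈ D, ∏ l ∈ T, 2 / (l : ℝ) / (1 - 2 / (l : ℝ)) with hSdef
  set E := ∑ U ∈ Py.powerset with ∏ l ∈ U, l ≤ y, ∏ l ∈ U, ((l : ℝ) - 1)⁻¹ with hE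
  have hlogpos : 0 < Real.log y := Real.log_pos (by exact_mod_cast hy)
  have hratio : 0 < (Q / Q.totient : ℝ) := by
    have := Nat.totient_pos.2 (Nat.pos_of_ne_zero hQ)
    have := Nat.pos_of_ne_zero hQ
    positivity
  have hSlow : Real.log y ^ 2 ≤ (Q / Q.totient : ℝ) ^ 2 * S := by
    calc Real.log y ^ 2 ≤ ((Q / Q.totient : ℝ) * E) ^ 2 := by gcongr
      _ = (Q / Q.totient : ℝ) ^ 2 * E ^ 2 := by ring
      _ ≤ _ := by gcongr
  have hSpos : 0 < S := by
    have h1 : 0 < Real.log y ^ 2 := by positivity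
    have h2 := h1.trans_le hSlow
    exact pos_of_mul_pos_right h2 (by positivity)
  refine hAle.trans (hsieve.trans (add_le_add ?_ ?_))
  · rw [div_le_div_iff₀ hSpos (by positivity), mul_assoc]
    gcongr
  · have hnn : 0 ≤ ∑ T ∈ D, (∏ l ∈ T, 2 / (l : ℝ))⁻¹ :=
      sum_nonneg fun T _ => inv_nonneg.2 (prod_nonneg fun l _ => by positivity)
    calc (z : ℝ) ^ 2 * (∑ T ∈ D, (∏ l ∈ T, 2 / (l : ℝ))⁻¹) ^ 2 ≤
          (z : ℝ) ^ 2 * ((z : ℝ) ^ 2) ^ 2 := by gcongr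
      _ = (y : ℝ) ^ 12 := by rw [hz]; push_cast; ring

theorem one_add_sq_le_three_mul {u v : ℝ} (h : |u - v| ≤ 1) : 1 + u ^ 2 ≤ 3 * (1 + v ^ 2) := by
  rw [abs_le] at h
  nlinarith [sq_nonneg (v - (u - v)), sq_nonneg (u - v)]

theorem inv_one_add_sq_le_arctan (b : ℝ) :
    (1 + b ^ 2)⁻¹ ≤ 3 * (Real.arctan (b + 1) - Real.arctan b) := by
  obtain ⟨ξ, hξ, h⟩ := exists_deriv_eq_slope Real.arctan (lt_add_one b)
    Real.continuous_arctan.continuousOn Real.differentiable_arctan.differentiableOn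
  simp only [Real.deriv_arctan, add_sub_cancel_left, div_one, one_div] at h
  rw [← h]
  have h1 : 1 + ξ ^ 2 ≤ 3 * (1 + b ^ 2) :=
    one_add_sq_le_three_mul (abs_le.2 ⟨by linarith [hξ.1], by linarith [hξ.2]⟩)
  rw [inv_le_iff_one_le_mul₀ (by positivity)]
  have h2 : 0 < 1 + ξ ^ 2 := by positivity
  calc (1 : ℝ) = (1 + ξ ^ 2)⁻¹ * (1 + ξ ^ 2) := (inv_mul_cancel₀ h2.ne').symm
    _ ≤ (1 + ξ ^ 2)⁻¹ * (3 * (1 + b ^ 2)) := by gcongr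
    _ = _ := by ring

theorem sum_inv_one_add_sq_le (M : ℕ) (x : ℝ) :
    ∑ i ∈ range M, (1 + ((i : ℝ) - x) ^ 2)⁻¹ ≤ 12 := by
  have h1 : ∑ i ∈ range M, (1 + ((i : ℝ) - x) ^ 2)⁻¹ ≤
      ∑ i ∈ range M, 3 * (Real.arctan ((i + 1 : ℕ) - x) - Real.arctan ((i : ℝ) - x)) := by
    refine sum_le_sum fun i _ => (inv_one_add_sq_le_arctan _).trans_eq ?_
    push_cast
    ring_nf
  rw [← mul_sum, sum_range_sub (fun i : ℕ => Real.arctan ((i : ℝ) - x))] at h1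
  have h2 := Real.arctan_lt_pi_div_two ((M : ℝ) - x)
  have h3 := Real.neg_pi_div_two_lt_arctan (((0 : ℕ) : ℝ) - x)
  have := Real.pi_lt_four
  linarith

open ArithmeticFunction in
theorem sum_vonMangoldt_add_one_div_le (s : Finset ℕ) (y : ℝ) :
    ∑ n ∈ s, (vonMangoldt n + 1) / n * (1 + (Real.log n - y) ^ 2)⁻¹ ≤ 1000 := by
  set w : ℕ → ℝ := fun n => (vonMangoldt n + 1) / n * (1 + (Real.log n - y) ^ 2)⁻¹ with hw
  have hw0 : ∀ n, 0 ≤ w n := fun n => by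
    have := vonMangoldt_nonneg (n := n)
    positivity
  set M := s.sup (fun n => ⌊Real.log n⌋₊) + 1 with hM
  have hmaps : ∀ n ∈ s, ⌊Real.log n⌋₊ ∈ range M := fun n hn =>
    mem_range.2 (Nat.lt_succ_of_le (le_sup (f := fun n : ℕ => ⌊Real.log n⌋₊) hn))
  have hblock : ∀ m : ℕ, ∑ n ∈ s with ⌊Real.log (n : ℕ)⌋₊ = m, w n ≤
      81 * (1 + ((m : ℝ) - y) ^ 2)⁻¹ := by
    intro m
    set E := Real.exp (m + 1) with hE
    have hEpos : 0 < E := Real.exp_pos _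
    have hpt : ∀ n ∈ s.filter (fun n : ℕ => ⌊Real.log n⌋₊ = m), w n ≤
        if n ∈ Ioc 0 ⌊E⌋₊ then
        (vonMangoldt n + 1) * (3 * Real.exp 1 / E * (1 + ((m : ℝ) - y) ^ 2)⁻¹) else 0 := by
      intro n hn
      have hnm := (mem_filter.1 hn).2
      rcases Nat.eq_zero_or_pos n with rfl | hn0
      · simp [hw]
      have hn0' : (0 : ℝ) < n := by exact_mod_cast hn0
      have hlog : 0 ≤ Real.log n := Real.log_natCast_nonneg n
      have h1 : (m : ℝ) ≤ Real.log n := by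
        rw [← hnm]; exact Nat.floor_le hlog
      have h2 : Real.log n < m + 1 := by
        rw [← hnm]; exact Nat.lt_floor_add_one _
      have h3 : (n : ℝ) ≤ E := by
        rw [hE, ← Real.log_le_iff_le_exp hn0']; exact h2.le
      rw [if_pos (mem_Ioc.2 ⟨hn0, Nat.le_floor h3⟩)]
      have h4 : E / Real.exp 1 ≤ n := by
        rw [hE, ← Real.exp_sub, add_sub_cancel_right, ← Real.le_log_iff_exp_le hn0']
        exact h1
      have h5 : (1 + (Real.log n - y) ^ 2)⁻¹ ≤ 3 * (1 + ((m : ℝ) - y) ^ 2)⁻¹ := by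
        have := one_add_sq_le_three_mul (u := m - y) (v := Real.log n - y)
          (abs_le.2 ⟨by linarith, by linarith⟩)
        rw [← div_eq_mul_inv, le_div_iff₀ (by positivity), inv_mul_le_iff₀ (by positivity)]
        linarith
      have h6 : (1 : ℝ) / n ≤ Real.exp 1 / E := by
        rw [div_le_div_iff₀ hn0' hEpos]
        rw [div_le_iff₀ (Real.exp_pos _)] at h4
        linarith
      have hΛ := vonMangoldt_nonneg (n := n)
      calc w n = (vonMangoldt n + 1) * (1 / n * (1 + (Real.log n - y) ^ 2)⁻¹) := by
            simp only [hw]; ring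
        _ ≤ (vonMangoldt n + 1) * (Real.exp 1 / E * (3 * (1 + ((m : ℝ) - y) ^ 2)⁻¹)) := by
            gcongr
        _ = _ := by ring
    have hψ := Chebyshev.psi_le_const_mul_self hEpos.le
    have hlog4 : Real.log 4 < 2 := by
      rw [show (4 : ℝ) = 2 ^ 2 by norm_num, Real.log_pow]
      have := Real.log_two_lt_d9
      push_cast
      linarith
    have he := Real.exp_one_lt_d9
    calc ∑ n ∈ s with ⌊Real.log (n : ℕ)⌋₊ = m, w n ≤ ∑ n ∈ s with ⌊Real.log (n : ℕ)⌋₊ = m,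
          if n ∈ Ioc 0 ⌊E⌋₊ then
          (vonMangoldt n + 1) * (3 * Real.exp 1 / E * (1 + ((m : ℝ) - y) ^ 2)⁻¹) else 0 :=
          sum_le_sum hpt
      _ ≤ ∑ n ∈ Ioc 0 ⌊E⌋₊,
          (vonMangoldt n + 1) * (3 * Real.exp 1 / E * (1 + ((m : ℝ) - y) ^ 2)⁻¹) := by
          rw [← sum_filter]
          refine sum_le_sum_of_subset_of_nonneg (fun n hn => (mem_filter.1 hn).2) fun n _ _ => ?_
          have := vonMangoldt_nonneg (n := n)
          positivity
      _ = (Chebyshev.psi E + ⌊E⌋₊) * (3 * Real.exp 1 / E * (1 + ((m : ℝ) - y) ^ 2)⁻¹) := by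
          rw [← sum_mul, sum_add_distrib, Chebyshev.psi]
          simp
      _ ≤ (9 * E) * (3 * 3 / E * (1 + ((m : ℝ) - y) ^ 2)⁻¹) := by
          have := Nat.floor_le hEpos.le
          gcongr
          · nlinarith
          · linarith
      _ = _ := by field_simp; ring
  calc ∑ n ∈ s, w n = ∑ m ∈ range M, ∑ n ∈ s with ⌊Real.log (n : ℕ)⌋₊ = m, w n :=
        (sum_fiberwise_of_maps_to hmaps _).symm
    _ ≤ ∑ m ∈ range M, 81 * (1 + ((m : ℝ) - y) ^ 2)⁻¹ := sum_le_sum fun m _ => hblock m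
    _ ≤ 81 * 12 := by
        rw [← mul_sum]
        gcongr
        exact sum_inv_one_add_sq_le M y
    _ ≤ 1000 := by norm_num

open ArithmeticFunction in
theorem summable_vonMangoldt_add_one_div (y : ℝ) :
    Summable fun n : ℕ => (vonMangoldt n + 1) / n * (1 + (Real.log n - y) ^ 2)⁻¹ :=
  summable_of_sum_le (fun n => by have := vonMangoldt_nonneg (n := n); positivity)
    (sum_vonMangoldt_add_one_div_le · y)

theorem integral_one_sub_div_mul_exp {T : ℝ} (hT : 0 < T) {c : ℂ} (hc : c ≠ 0) :
    ∫ t in (0 : ℝ)..T, (1 - t / T : ℂ) * Complex.exp (c * t) =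
      (Complex.exp (c * T) - 1) / (T * c ^ 2) - 1 / c := by
  have hT' : (T : ℂ) ≠ 0 := by exact_mod_cast hT.ne'
  have hderiv : ∀ t ∈ Set.uIcc 0 T, HasDerivAt
      (fun t : ℝ => (1 - t / T : ℂ) * Complex.exp (c * t) / c +
        Complex.exp (c * t) / (T * c ^ 2)) ((1 - t / T : ℂ) * Complex.exp (c * t)) t := by
    intro t _
    have h1 : HasDerivAt (fun t : ℝ => (t : ℂ)) 1 t := Complex.ofRealCLM.hasDerivAt
    have h2 : HasDerivAt (fun t : ℝ => Complex.exp (c * t)) (Complex.exp (c * t) * (c * 1)) t :=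
      (h1.const_mul c).cexp
    have h3 := (((h1.div_const (T : ℂ)).const_sub 1).mul h2).div_const c
    have h4 := h3.add (h2.div_const (T * c ^ 2))
    refine h4.congr_deriv ?_
    field_simp
    ring
  rw [intervalIntegral.integral_eq_sub_of_hasDerivAt hderiv
    (Continuous.intervalIntegrable (by fun_prop) _ _)]
  simp only [Complex.ofReal_zero, zero_div, sub_zero, mul_zero, Complex.exp_zero,
    div_self hT', sub_self, zero_mul]
  ring

/-- The Fourier transform of the Fejér (triangle) kernel. -/
theorem integral_fejer_mul_exp {T : ℝ} (hT : 0 < T) (u : ℝ) :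
    ∫ t in (-T)..T, ((1 - |t| / T : ℝ) : ℂ) * Complex.exp (-(t * u * Complex.I)) =
      ((T * Real.sinc (T * u / 2) ^ 2 : ℝ) : ℂ) := by
  have hT' : (T : ℂ) ≠ 0 := by exact_mod_cast hT.ne'
  have hcont : Continuous fun t : ℝ =>
      ((1 - |t| / T : ℝ) : ℂ) * Complex.exp (-(t * u * Complex.I)) := by fun_prop
  rw [← intervalIntegral.integral_add_adjacent_intervals (b := 0)
    (hcont.intervalIntegrable _ _) (hcont.intervalIntegrable _ _)]
  have hneg := intervalIntegral.integral_comp_neg (a := 0) (b := T) (fun t : ℝ =>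
      ((1 - |t| / T : ℝ) : ℂ) * Complex.exp (-(t * u * Complex.I)))
  rw [neg_zero] at hneg
  rw [← hneg]
  have h1 : ∫ t in (0 : ℝ)..T, ((1 - |t| / T : ℝ) : ℂ) * Complex.exp (-(t * u * Complex.I)) =
      ∫ t in (0 : ℝ)..T, (1 - t / T : ℂ) * Complex.exp (-(u * Complex.I) * t) := by
    refine intervalIntegral.integral_congr fun t ht => ?_
    rw [Set.uIcc_of_le hT.le] at ht
    simp only [abs_of_nonneg ht.1]
    push_cast
    ring_nf
  have h2 : ∫ t in (0 : ℝ)..T, ((1 - |-t| / T : ℝ) : ℂ) *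
        Complex.exp (-((-t : ℝ) * u * Complex.I)) =
      ∫ t in (0 : ℝ)..T, (1 - t / T : ℂ) * Complex.exp (u * Complex.I * t) := by
    refine intervalIntegral.integral_congr fun t ht => ?_
    rw [Set.uIcc_of_le hT.le] at ht
    simp only [abs_neg, abs_of_nonneg ht.1]
    push_cast
    ring_nf
  rw [h1, h2]
  rcases eq_or_ne u 0 with rfl | hu
  · simp only [Complex.ofReal_zero, zero_mul, neg_zero, Complex.exp_zero, mul_one, mul_zero,
      zero_div, Real.sinc_zero, one_pow]
    have h3 : ∫ t in (0 : ℝ)..T, (1 - t / T : ℂ) = T / 2 := by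
      have h4 : ∀ t : ℝ, (1 - t / T : ℂ) = ((1 - t / T : ℝ) : ℂ) := fun t => by push_cast; ring
      simp_rw [h4]
      rw [intervalIntegral.integral_ofReal, intervalIntegral.integral_sub (by simp)
        (Continuous.intervalIntegrable (by fun_prop) _ _), intervalIntegral.integral_div]
      simp
      field_simp
      ring
    rw [h3]
    ring
  · have hu' : (u : ℂ) ≠ 0 := by exact_mod_cast hu
    have hc : (u * Complex.I : ℂ) ≠ 0 := mul_ne_zero hu' Complex.I_ne_zero
    rw [integral_one_sub_div_mul_exp hT hc, integral_one_sub_div_mul_exp hT (neg_ne_zero.2 hc)]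
    have h3 : Complex.exp (u * Complex.I * T) + Complex.exp (-(u * Complex.I) * T) =
        2 * Real.cos (u * T) := by
      rw [Complex.ofReal_cos, Complex.two_cos]
      push_cast
      ring_nf
    have h4 : Real.sinc (T * u / 2) ^ 2 = 2 * (1 - Real.cos (u * T)) / (T * u) ^ 2 := by
      have : T * u / 2 ≠ 0 := by positivity
      rw [Real.sinc_of_ne_zero this, div_pow, Real.sin_sq_eq_half_sub,
        show 2 * (T * u / 2) = u * T by ring]
      field_simp
    rw [h4]
    have h5 : (u * Complex.I : ℂ) ^ 2 = -u ^ 2 := by rw [mul_pow, Complex.I_sq]; ring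
    rw [neg_sq, h5]
    have h6 : (Complex.exp (u * Complex.I * T) - 1) / (T * -u ^ 2) - 1 / (u * Complex.I) +
        ((Complex.exp (-(u * Complex.I) * T) - 1) / (T * -u ^ 2) - 1 / -(u * Complex.I)) =
        ((Complex.exp (u * Complex.I * T) + Complex.exp (-(u * Complex.I) * T)) - 2) /
          (T * -u ^ 2) := by
      rw [div_neg 1]
      ring
    rw [h6, h3]
    push_cast
    field_simp
    ring

theorem fejer_le {T : ℝ} (hT : 0 < T) (u : ℝ) :
    T * Real.sinc (T * u / 2) ^ 2 ≤ 5 * T * (1 + (T * u) ^ 2)⁻¹ := by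
  rw [mul_comm 5 T, mul_assoc]
  refine mul_le_mul_of_nonneg_left ?_ hT.le
  rw [← div_eq_mul_inv, le_div_iff₀ (by positivity)]
  have h1 : Real.sinc (T * u / 2) ^ 2 ≤ 1 := by
    rw [sq_le_one_iff_abs_le_one]
    exact Real.abs_sinc_le_one _
  have h2 : Real.sinc (T * u / 2) ^ 2 * (T * u) ^ 2 ≤ 4 := by
    rcases eq_or_ne (T * u / 2) 0 with h | h
    · have : T * u = 0 := by linarith
      rw [this]; norm_num
    · have h3 : T * u = 2 * (T * u / 2) := by ring
      rw [← mul_pow]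
      nth_rewrite 2 [h3]
      rw [Real.sinc_of_ne_zero h, show Real.sin (T * u / 2) / (T * u / 2) * (2 * (T * u / 2)) =
        2 * Real.sin (T * u / 2) by rw [div_mul_eq_mul_div, div_eq_iff h]; ring]
      nlinarith [Real.sin_sq_le_one (T * u / 2)]
  nlinarith

theorem le_fejer {T : ℝ} (hT : 0 < T) {u : ℝ} (hu : |T * u| ≤ 1) :
    T / 4 ≤ T * Real.sinc (T * u / 2) ^ 2 := by
  have h1 : 1 / 2 ≤ Real.sinc (T * u / 2) := by
    have h2 : |T * u / 2| ≤ 1 := by rw [abs_div, abs_two]; linarith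
    rcases eq_or_ne (T * u / 2) 0 with h | h
    · rw [h, Real.sinc_zero]; norm_num
    have h3 : Real.sinc (T * u / 2) = Real.sinc |T * u / 2| := by
      rcases abs_choice (T * u / 2) with h' | h' <;> rw [h']
      rw [Real.sinc_neg]
    have hpos := abs_pos.2 h
    rw [h3, Real.sinc_of_ne_zero hpos.ne', le_div_iff₀ hpos]
    have h4 := Real.mul_le_sin hpos.le (h2.trans (by linarith [Real.pi_gt_three]))
    refine le_trans (mul_le_mul_of_nonneg_right ?_ hpos.le) h4
    rw [div_le_div_iff₀ two_pos Real.pi_pos]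
    linarith [Real.pi_lt_four]
  have : (1 / 4 : ℝ) ≤ Real.sinc (T * u / 2) ^ 2 := by nlinarith
  nlinarith

end

section

open Finset Filter Topology

open ArithmeticFunction in
theorem LSeriesSummable_of_abs_le_vonMangoldt_add_one {D : ℕ → ℝ}
    (hD : ∀ n, |D n| ≤ vonMangoldt n + 1) {s : ℂ} (hs : 1 < s.re) :
    LSeriesSummable (fun n => (D n : ℂ)) s := by
  have h1 := LSeriesSummable_vonMangoldt hs
  have h2 := LSeriesSummable_one_iff.2 hs
  have h3 := h1.norm.add h2.norm
  refine Summable.of_norm (h3.of_nonneg_of_le (fun _ => norm_nonneg _) fun n => ?_)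
  rcases eq_or_ne n 0 with rfl | hn
  · simp
  · have hΛ := vonMangoldt_nonneg (n := n)
    simp only [LSeries.term_of_ne_zero hn, norm_div, Pi.one_apply, ← add_div]
    gcongr
    simp only [Complex.norm_real, Real.norm_eq_abs, norm_one]
    rw [abs_of_nonneg hΛ]
    exact hD n

theorem term_mul_fejer (D : ℕ → ℝ) {σ : ℝ} (hσ : σ ≠ 0) (T y t : ℝ) (n : ℕ) :
    ((1 - |t| / T : ℝ) : ℂ) * Complex.exp (t * y * Complex.I) *
      LSeries.term (fun n => (D n : ℂ)) (σ + t * Complex.I) n =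
    ((D n * (n : ℝ) ^ (-σ) : ℝ) : ℂ) * (((1 - |t| / T : ℝ) : ℂ) *
      Complex.exp (-(t * (Real.log n - y : ℝ) * Complex.I))) := by
  rcases eq_or_ne n 0 with rfl | hn
  · simp [Real.zero_rpow (neg_ne_zero.2 hσ)]
  · have hn' : (n : ℂ) ≠ 0 := by exact_mod_cast hn
    have hn0 : (0 : ℝ) < n := by positivity
    rw [LSeries.term_of_ne_zero hn, Complex.cpow_def_of_ne_zero hn', Real.rpow_def_of_pos hn0,
      div_eq_mul_inv (D n : ℂ), ← Complex.exp_neg, Complex.ofReal_mul, Complex.ofReal_exp,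
      ← Complex.natCast_log]
    have h1 : Complex.exp (t * y * Complex.I) *
        Complex.exp (-(Real.log n * (σ + t * Complex.I))) =
        Complex.exp ((Real.log n * -σ : ℝ)) *
        Complex.exp (-(t * (Real.log n - y : ℝ) * Complex.I)) := by
      rw [← Complex.exp_add, ← Complex.exp_add]
      congr 1
      push_cast
      ring
    linear_combination ((1 - |t| / T : ℝ) : ℂ) * (D n : ℂ) * h1

open ArithmeticFunction in
theorem hasSum_mul_fejer {D : ℕ → ℝ} (hD : ∀ n, |D n| ≤ vonMangoldt n + 1) {σ : ℝ} (hσ : 1 < σ)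
    {T : ℝ} (hT : 0 < T) (y : ℝ) :
    HasSum (fun n : ℕ => ((D n * (n : ℝ) ^ (-σ) *
        (T * Real.sinc (T * (Real.log n - y) / 2) ^ 2) : ℝ) : ℂ))
      (∫ t in (-T)..T, ((1 - |t| / T : ℝ) : ℂ) * Complex.exp (t * y * Complex.I) *
        LSeries (fun n => (D n : ℂ)) (σ + t * Complex.I)) := by
  have hσ0 : σ ≠ 0 := by linarith
  have hre : ∀ t : ℝ, (σ + t * Complex.I : ℂ).re = σ := fun t => by simp
  have hsum : ∀ t : ℝ, LSeriesSummable (fun n => (D n : ℂ)) (σ + t * Complex.I) := fun t =>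
    LSeriesSummable_of_abs_le_vonMangoldt_add_one hD (by rw [hre]; exact hσ)
  have hnorm : ∀ n t, ‖LSeries.term (fun n => (D n : ℂ)) (σ + (t : ℝ) * Complex.I) n‖ =
      ‖LSeries.term (fun n => (D n : ℂ)) (σ + (0 : ℝ) * Complex.I) n‖ := fun n t => by
    rw [LSeries.norm_term_eq, LSeries.norm_term_eq, hre, hre]
  have key := intervalIntegral.hasSum_integral_of_dominated_convergence (a := -T) (b := T)
    (μ := MeasureTheory.volume)
    (F := fun n t => ((1 - |t| / T : ℝ) : ℂ) * Complex.exp (t * y * Complex.I) *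
      LSeries.term (fun n => (D n : ℂ)) (σ + t * Complex.I) n)
    (f := fun t => ((1 - |t| / T : ℝ) : ℂ) * Complex.exp (t * y * Complex.I) *
        LSeries (fun n => (D n : ℂ)) (σ + t * Complex.I))
    (fun n _ => ‖LSeries.term (fun n => (D n : ℂ)) (σ + (0 : ℝ) * Complex.I) n‖)
    (fun n => by
      simp_rw [term_mul_fejer D hσ0]
      exact Continuous.aestronglyMeasurable (by fun_prop))
    (fun n => Eventually.of_forall fun t ht => by
      rw [norm_mul, hnorm n t]
      refine mul_le_of_le_one_left (norm_nonneg _) ?_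
      have h1 : (t * y * Complex.I : ℂ) = ((t * y : ℝ) : ℂ) * Complex.I := by push_cast; ring
      rw [norm_mul, h1, Complex.norm_exp_ofReal_mul_I, mul_one, Complex.norm_real,
        Real.norm_eq_abs]
      rw [Set.uIoc_of_le (by linarith)] at ht
      have h2 : |t| / T ≤ 1 := (div_le_one hT).2 (abs_le.2 ⟨ht.1.le, ht.2⟩)
      have h3 : 0 ≤ |t| / T := by positivity
      exact abs_le.2 ⟨by linarith, by linarith⟩)
    (Eventually.of_forall fun t _ => (hsum 0).norm)
    (by simp)
    (Eventually.of_forall fun t _ => (hsum t).hasSum.mul_left _)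
  refine key.congr_fun fun n => ?_
  simp_rw [term_mul_fejer D hσ0]
  rw [intervalIntegral.integral_const_mul, integral_fejer_mul_exp hT, ← Complex.ofReal_mul]

theorem fejer_le_mul_inv {T : ℝ} (hT : 1 ≤ T) (u : ℝ) :
    T * Real.sinc (T * u / 2) ^ 2 ≤ 5 * T * (1 + u ^ 2)⁻¹ := by
  refine (fejer_le (by linarith) u).trans ?_
  have : u ^ 2 ≤ (T * u) ^ 2 := by
    rw [mul_pow]
    exact le_mul_of_one_le_left (sq_nonneg u) (one_le_pow₀ hT)
  gcongr

open ArithmeticFunction in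
theorem abs_mul_rpow_mul_fejer_le {D : ℕ → ℝ} (hD : ∀ n, |D n| ≤ vonMangoldt n + 1) {σ : ℝ}
    (hσ : 1 ≤ σ) {T : ℝ} (hT : 1 ≤ T) (y : ℝ) (n : ℕ) :
    |D n * (n : ℝ) ^ (-σ) * (T * Real.sinc (T * (Real.log n - y) / 2) ^ 2)| ≤
      5 * T * ((vonMangoldt n + 1) / n * (1 + (Real.log n - y) ^ 2)⁻¹) := by
  have h1 : (n : ℝ) ^ (-σ) ≤ (n : ℝ)⁻¹ := by
    rcases Nat.eq_zero_or_pos n with rfl | hn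
    · simp [Real.zero_rpow (by linarith : -σ ≠ 0)]
    · rw [← Real.rpow_neg_one]
      exact Real.rpow_le_rpow_of_exponent_le (by exact_mod_cast hn) (by linarith)
  have h2 : 0 ≤ T * Real.sinc (T * (Real.log n - y) / 2) ^ 2 := by positivity
  have h3 : 0 ≤ (n : ℝ) ^ (-σ) := by positivity
  have hΛ := vonMangoldt_nonneg (n := n)
  rw [abs_mul, abs_mul, abs_of_nonneg h2, abs_of_nonneg h3]
  calc |D n| * (n : ℝ) ^ (-σ) * (T * Real.sinc (T * (Real.log n - y) / 2) ^ 2) ≤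
      (vonMangoldt n + 1) * (n : ℝ)⁻¹ * (5 * T * (1 + (Real.log n - y) ^ 2)⁻¹) :=
        mul_le_mul (mul_le_mul (hD n) h1 h3 (by positivity)) (fejer_le_mul_inv hT _) h2
          (by positivity)
    _ = _ := by ring

open ArithmeticFunction in
theorem tsum_mul_fejer_eq_integral {D : ℕ → ℝ} (hD : ∀ n, |D n| ≤ vonMangoldt n + 1) {G : ℂ → ℂ}
    (hG : ContinuousOn G {s | 1 ≤ s.re})
    (hDG : ∀ s : ℂ, 1 < s.re → LSeries (fun n => (D n : ℂ)) s = G s)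
    {T : ℝ} (hT : 1 ≤ T) (y : ℝ) :
    ((∑' n : ℕ, D n * (n : ℝ) ^ (-1 : ℝ) *
        (T * Real.sinc (T * (Real.log n - y) / 2) ^ 2) : ℝ) : ℂ) =
      ∫ t in (-T)..T, ((1 - |t| / T : ℝ) : ℂ) * Complex.exp (t * y * Complex.I) *
        G (1 + t * Complex.I) := by
  have hT0 : 0 < T := by linarith
  have hlhs : Tendsto (fun σ : ℝ => ∑' n : ℕ, D n * (n : ℝ) ^ (-σ) *
      (T * Real.sinc (T * (Real.log n - y) / 2) ^ 2)) (𝓝[>] 1)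
      (𝓝 (∑' n : ℕ, D n * (n : ℝ) ^ (-1 : ℝ) *
        (T * Real.sinc (T * (Real.log n - y) / 2) ^ 2))) := by
    refine tendsto_tsum_of_dominated_convergence
      ((summable_vonMangoldt_add_one_div y).mul_left (5 * T)) (fun n => ?_) ?_
    · refine Tendsto.mul_const _ (Tendsto.const_mul _ ?_)
      have h1 : ContinuousAt (fun σ : ℝ => (n : ℝ) ^ (-σ)) 1 :=
        ContinuousAt.comp (f := fun σ : ℝ => -σ) (g := fun σ : ℝ => (n : ℝ) ^ σ)
          (Real.continuousAt_const_rpow' (by norm_num)) continuous_neg.continuousAt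
      exact h1.tendsto.mono_left nhdsWithin_le_nhds
    · filter_upwards [self_mem_nhdsWithin] with σ hσ n
      exact abs_mul_rpow_mul_fejer_le hD (le_of_lt hσ) hT y n
  obtain ⟨M, hM⟩ := ((isCompact_Icc (a := (1 : ℝ)) (b := 2)).prod
    (isCompact_Icc (a := -T) (b := T))).exists_bound_of_continuousOn
    (f := fun p : ℝ × ℝ => G (p.1 + p.2 * Complex.I))
    (hG.comp (by fun_prop) (fun p hp => by simpa using hp.1.1))
  have hrhs : Tendsto (fun σ : ℝ => ∫ t in (-T)..T, ((1 - |t| / T : ℝ) : ℂ) *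
      Complex.exp (t * y * Complex.I) * G (σ + t * Complex.I)) (𝓝[>] 1)
      (𝓝 (∫ t in (-T)..T, ((1 - |t| / T : ℝ) : ℂ) * Complex.exp (t * y * Complex.I) *
        G ((1 : ℝ) + t * Complex.I))) := by
    refine intervalIntegral.tendsto_integral_filter_of_dominated_convergence (fun _ => M) ?_ ?_
      (by simp) ?_
    · filter_upwards [self_mem_nhdsWithin] with σ hσ
      have h1 : Continuous fun t : ℝ => G (σ + t * Complex.I) :=
        hG.comp_continuous (by fun_prop) fun t => by simpa using le_of_lt hσ
      exact Continuous.aestronglyMeasurable (Continuous.mul (by fun_prop) h1)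
    · filter_upwards [self_mem_nhdsWithin, Ioo_mem_nhdsGT (show (1 : ℝ) < 2 by norm_num)]
        with σ hσ hσ2
      refine Eventually.of_forall fun t ht => ?_
      rw [Set.uIoc_of_le (by linarith)] at ht
      refine le_trans ?_ (hM (σ, t) ⟨⟨le_of_lt hσ, hσ2.2.le⟩, ht.1.le, ht.2⟩)
      rw [norm_mul]
      refine mul_le_of_le_one_left (norm_nonneg _) ?_
      have h1 : (t * y * Complex.I : ℂ) = ((t * y : ℝ) : ℂ) * Complex.I := by push_cast; ring
      rw [norm_mul, h1, Complex.norm_exp_ofReal_mul_I, mul_one, Complex.norm_real,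
        Real.norm_eq_abs]
      have h2 : |t| / T ≤ 1 := (div_le_one hT0).2 (abs_le.2 ⟨ht.1.le, ht.2⟩)
      have h3 : 0 ≤ |t| / T := by positivity
      exact abs_le.2 ⟨by linarith, by linarith⟩
    · refine Eventually.of_forall fun t _ => Tendsto.const_mul _ ?_
      have h1 : ContinuousWithinAt (fun σ : ℝ => G (σ + t * Complex.I)) (Set.Ici 1) 1 :=
        ContinuousWithinAt.comp (f := fun σ : ℝ => (σ + t * Complex.I : ℂ)) (g := G)
          (hG _ (by simp))
          (by fun_prop) (fun σ hσ => by simpa using hσ)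
      exact h1.tendsto.mono_left (nhdsWithin_mono _ Set.Ioi_subset_Ici_self)
  have heq : ∀ᶠ σ : ℝ in 𝓝[>] 1, ((∑' n : ℕ, D n * (n : ℝ) ^ (-σ) *
      (T * Real.sinc (T * (Real.log n - y) / 2) ^ 2) : ℝ) : ℂ) =
      ∫ t in (-T)..T, ((1 - |t| / T : ℝ) : ℂ) *
      Complex.exp (t * y * Complex.I) * G (σ + t * Complex.I) := by
    filter_upwards [self_mem_nhdsWithin] with σ hσ
    rw [Complex.ofReal_tsum, (hasSum_mul_fejer hD hσ hT0 y).tsum_eq]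
    refine intervalIntegral.integral_congr fun t _ => ?_
    rw [hDG _ (by simpa using hσ)]
  have h1 := ((Complex.continuous_ofReal.tendsto _).comp hlhs).congr' heq
  simpa using tendsto_nhds_unique h1 hrhs

theorem tendsto_integral_mul_exp_atTop (φ : ℝ → ℂ) (a b : ℝ) (hab : a ≤ b) :
    Tendsto (fun y : ℝ => ∫ t in a..b, Complex.exp (t * y * Complex.I) * φ t) atTop (𝓝 0) := by
  have h1 := Real.tendsto_integral_exp_smul_cocompact ((Set.Ioc a b).indicator φ)
  have h2 : Tendsto (fun y : ℝ => -(y / (2 * Real.pi))) atTop (cocompact ℝ) := by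
    refine Tendsto.mono_right ?_ atBot_le_cocompact
    exact tendsto_neg_atTop_atBot.comp (tendsto_id.atTop_div_const (by positivity))
  refine (h1.comp h2).congr fun y => ?_
  rw [intervalIntegral.integral_of_le hab, ← MeasureTheory.integral_indicator measurableSet_Ioc]
  simp only [Function.comp]
  congr 1 with t
  by_cases ht : t ∈ Set.Ioc a b
  · simp only [Set.indicator_of_mem ht, Circle.smul_def, Real.fourierChar_apply, smul_eq_mul]
    congr 2
    have : (Real.pi : ℂ) ≠ 0 := by exact_mod_cast Real.pi_ne_zero
    push_cast
    field_simp
  · simp [Set.indicator_of_notMem ht]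

open ArithmeticFunction in
theorem tendsto_tsum_mul_fejer {D : ℕ → ℝ} (hD : ∀ n, |D n| ≤ vonMangoldt n + 1) {G : ℂ → ℂ}
    (hG : ContinuousOn G {s | 1 ≤ s.re})
    (hDG : ∀ s : ℂ, 1 < s.re → LSeries (fun n => (D n : ℂ)) s = G s) {T : ℝ} (hT : 1 ≤ T) :
    Tendsto (fun y : ℝ => ∑' n : ℕ, D n * (n : ℝ) ^ (-1 : ℝ) *
        (T * Real.sinc (T * (Real.log n - y) / 2) ^ 2)) atTop (𝓝 0) := by
  have h1 := tendsto_integral_mul_exp_atTop (fun t =>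
    ((1 - |t| / T : ℝ) : ℂ) * G (1 + t * Complex.I)) (-T) T (by linarith)
  have h2 := (Complex.continuous_re.tendsto _).comp h1
  rw [Complex.zero_re] at h2
  refine h2.congr fun y => ?_
  rw [Function.comp, ← Complex.ofReal_re (∑' n : ℕ, _), tsum_mul_fejer_eq_integral hD hG hDG hT y]
  congr 2 with t
  ring

open ArithmeticFunction in
theorem summable_mul_rpow_mul_fejer {D : ℕ → ℝ} (hD : ∀ n, |D n| ≤ vonMangoldt n + 1)
    {T : ℝ} (hT : 1 ≤ T) (y : ℝ) :
    Summable fun n : ℕ => D n * (n : ℝ) ^ (-1 : ℝ) *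
        (T * Real.sinc (T * (Real.log n - y) / 2) ^ 2) :=
  Summable.of_norm (((summable_vonMangoldt_add_one_div y).mul_left (5 * T)).of_nonneg_of_le
    (fun _ => norm_nonneg _) fun n => abs_mul_rpow_mul_fejer_le hD le_rfl hT y n)

open ArithmeticFunction in
theorem eventually_le_tsum_inv_mul_fejer {T : ℝ} (hT : 1 ≤ T) :
    ∀ᶠ y : ℝ in atTop, 1 / 16 ≤ ∑' n : ℕ, 1 * (n : ℝ) ^ (-1 : ℝ) *
        (T * Real.sinc (T * (Real.log n - y) / 2) ^ 2) := by
  have h0 : Tendsto (fun y : ℝ => T * Real.exp (-y)) atTop (𝓝 (T * 0)) :=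
    Real.tendsto_exp_neg_atTop_nhds_zero.const_mul T
  rw [mul_zero] at h0
  filter_upwards [h0.eventually (gt_mem_nhds (show (0 : ℝ) < 1 / 4 by norm_num))] with y hy
  have hT0 : 0 < T := by linarith
  set x := T⁻¹ with hx
  have hx0 : 0 < x := by positivity
  have hx1 : x ≤ 1 := inv_le_one_of_one_le₀ hT
  have hTx : T * x = 1 := mul_inv_cancel₀ hT0.ne'
  set S := Ioc ⌊Real.exp y⌋₊ ⌊Real.exp (y + x)⌋₊ with hS
  have hsum := summable_mul_rpow_mul_fejer (D := fun _ => 1)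
    (fun n => by have := vonMangoldt_nonneg (n := n); simp [this]) hT y
  refine le_trans ?_ (hsum.sum_le_tsum S fun n _ => by positivity)
  have hterm : ∀ n ∈ S, Real.exp (-(y + x)) * (T / 4) ≤ 1 * (n : ℝ) ^ (-1 : ℝ) *
        (T * Real.sinc (T * (Real.log n - y) / 2) ^ 2) := by
    intro n hn
    rw [hS, mem_Ioc] at hn
    have h1 : Real.exp y < n := (Nat.floor_lt (Real.exp_pos _).le).1 hn.1
    have hn0 : (0 : ℝ) < n := (Real.exp_pos _).trans h1
    have h2 : (n : ℝ) ≤ Real.exp (y + x) := (Nat.le_floor_iff (Real.exp_pos _).le).1 hn.2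
    have h3 : y < Real.log n := (Real.lt_log_iff_exp_lt hn0).2 h1
    have h4 : Real.log n ≤ y + x := (Real.log_le_iff_le_exp hn0).2 h2
    rw [one_mul, Real.rpow_neg_one, Real.exp_neg]
    refine mul_le_mul (inv_anti₀ hn0 h2) (le_fejer hT0 ?_) (by positivity) (by positivity)
    rw [abs_of_nonneg (mul_nonneg hT0.le (by linarith)), ← hTx]
    gcongr
    linarith
  have hcard : Real.exp (y + x) - 1 - Real.exp y ≤ #S := by
    have h1 : (⌊Real.exp (y + x)⌋₊ : ℝ) - ⌊Real.exp y⌋₊ ≤ #S := by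
      rw [hS, Nat.card_Ioc]
      exact sub_le_iff_le_add.2 (by exact_mod_cast le_tsub_add)
    have h2 := Nat.floor_le (Real.exp_pos y).le
    have h3 := Nat.lt_floor_add_one (Real.exp (y + x))
    linarith
  have h5 := card_nsmul_le_sum S _ _ hterm
  refine le_trans ?_ h5
  rw [nsmul_eq_mul]
  have h6 : Real.exp (-x) ≤ 1 - x / 2 := by
    rw [Real.exp_neg]
    have h7 := Real.add_one_le_exp x
    rw [inv_le_iff_one_le_mul₀ (Real.exp_pos _)]
    nlinarith
  have h8 : Real.exp (y + x) * Real.exp (-(y + x)) = 1 := by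
    rw [← Real.exp_add, add_neg_cancel, Real.exp_zero]
  have h9 : Real.exp y * Real.exp (-(y + x)) = Real.exp (-x) := by
    rw [← Real.exp_add]; ring_nf
  have h10 : Real.exp (-(y + x)) ≤ Real.exp (-y) := Real.exp_le_exp.2 (by linarith)
  have h11 : (Real.exp (y + x) - 1 - Real.exp y) * (Real.exp (-(y + x)) * (T / 4)) ≤
      #S * (Real.exp (-(y + x)) * (T / 4)) := by gcongr
  refine le_trans ?_ h11
  have h12 : (Real.exp (y + x) - 1 - Real.exp y) * (Real.exp (-(y + x)) * (T / 4)) =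
      (1 - Real.exp (-(y + x)) - Real.exp (-x)) * (T / 4) := by
    linear_combination (T / 4) * (h8 - h9)
  rw [h12]
  have h13 : (x / 2 - Real.exp (-y)) * (T / 4) ≤
      (1 - Real.exp (-(y + x)) - Real.exp (-x)) * (T / 4) :=
    mul_le_mul_of_nonneg_right (by linarith) (by linarith)
  nlinarith

theorem exists_continuousOn_riemannZeta_sub : ∃ Z : ℂ → ℂ, ContinuousOn Z {s | 1 ≤ s.re} ∧
    ∀ s : ℂ, 1 < s.re → Z s = riemannZeta s - 1 / (s - 1) := by
  refine ⟨Function.update (fun s => riemannZeta s - 1 / (s - 1)) 1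
    (Real.eulerMascheroniConstant : ℂ), ?_, fun s hs => ?_⟩
  · refine Continuous.continuousOn (continuous_iff_continuousAt.2 fun s => ?_)
    rcases eq_or_ne s 1 with rfl | hs
    · exact continuousAt_update_same.2 tendsto_riemannZeta_sub_one_div
    · rw [continuousAt_update_of_ne hs]
      exact (differentiableAt_riemannZeta hs).continuousAt.sub
        (continuousAt_const.div (by fun_prop) (sub_ne_zero.2 hs))
  · rw [Function.update_of_ne]
    rintro rfl
    simp at hs

open ArithmeticFunction vonMangoldt in
theorem eventually_le_tsum_residueClass_mul_fejer {q : ℕ} [NeZero q] {a : ZMod q} (ha : IsUnit a)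
    {T : ℝ} (hT : 1 ≤ T) :
    ∀ᶠ y : ℝ in atTop, (q.totient : ℝ)⁻¹ / 32 ≤ ∑' n : ℕ, residueClass a n * (n : ℝ) ^ (-1 : ℝ) *
        (T * Real.sinc (T * (Real.log n - y) / 2) ^ 2) := by
  obtain ⟨Z, hZ, hZs⟩ := exists_continuousOn_riemannZeta_sub
  set A : ℝ := (q.totient : ℝ)⁻¹ with hA
  have hφ : 0 < q.totient := Nat.totient_pos.2 (NeZero.pos q)
  have hA0 : 0 < A := by positivity
  have hA1 : A ≤ 1 := inv_le_one_of_one_le₀ (by exact_mod_cast hφ)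
  have hf : ∀ n, |residueClass a n| ≤ vonMangoldt n + 1 := fun n => by
    rw [abs_of_nonneg (residueClass_nonneg a n)]
    linarith [residueClass_le a n]
  have h1 : ∀ n : ℕ, |(1 : ℝ)| ≤ vonMangoldt n + 1 := fun n => by
    have := vonMangoldt_nonneg (n := n)
    simp [this]
  have hD : ∀ n, |residueClass a n - A| ≤ vonMangoldt n + 1 := fun n => by
    have h2 := residueClass_nonneg a n
    have h3 := residueClass_le a n
    exact abs_le.2 ⟨by linarith [vonMangoldt_nonneg (n := n)], by linarith⟩
  have key := tendsto_tsum_mul_fejer hD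
    (G := fun s => LFunctionResidueClassAux a s - A * Z s)
    ((continuousOn_LFunctionResidueClassAux a).sub (continuousOn_const.mul hZ))
    (fun s hs => by
      have h2 : (fun n => ((residueClass a n - A : ℝ) : ℂ)) =
          (fun n => (residueClass a n : ℂ)) - (A : ℂ) • (1 : ℕ → ℂ) := by
        ext n
        simp
      have hs1 := LSeriesSummable_of_abs_le_vonMangoldt_add_one hf hs
      have hs2 := (LSeriesSummable_one_iff.2 hs).smul (A : ℂ)
      rw [h2, LSeries_sub hs1 hs2, LSeries_smul, LSeries_one_eq_riemannZeta hs, hZs s hs,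
        eqOn_LFunctionResidueClassAux ha hs, hA]
      push_cast
      ring) hT
  filter_upwards [key.eventually (lt_mem_nhds (show -(A / 32) < 0 by linarith)),
    eventually_le_tsum_inv_mul_fejer hT] with y hy1 hy2
  have hs1 := summable_mul_rpow_mul_fejer hf hT y
  have hs2 := summable_mul_rpow_mul_fejer h1 hT y
  have h3 : ∑' n : ℕ, (residueClass a n - A) * (n : ℝ) ^ (-1 : ℝ) *
        (T * Real.sinc (T * (Real.log n - y) / 2) ^ 2) =
      (∑' n : ℕ, residueClass a n * (n : ℝ) ^ (-1 : ℝ) *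
        (T * Real.sinc (T * (Real.log n - y) / 2) ^ 2)) -
      A * ∑' n : ℕ, 1 * (n : ℝ) ^ (-1 : ℝ) *
        (T * Real.sinc (T * (Real.log n - y) / 2) ^ 2) := by
    rw [← tsum_mul_left, ← hs1.tsum_sub (hs2.mul_left A)]
    congr 1 with n
    ring
  rw [h3] at hy1
  nlinarith

open ArithmeticFunction vonMangoldt in
theorem tsum_residueClass_mul_fejer_le {q : ℕ} (a : ZMod q) {T δ : ℝ} (hT : 1 ≤ T) (hδ : 0 < δ)
    (y : ℝ) (S : Finset ℕ) (hS : ∀ n ∉ S, n ≠ 0 → δ ≤ |Real.log n - y|) :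
    ∑' n : ℕ, residueClass a n * (n : ℝ) ^ (-1 : ℝ) *
        (T * Real.sinc (T * (Real.log n - y) / 2) ^ 2) ≤
      ∑ n ∈ S, residueClass a n / n * (5 * T * (1 + (T * (Real.log n - y)) ^ 2)⁻¹) +
      5000 * (1 + (δ ^ 2)⁻¹) / T := by
  classical
  have hT0 : 0 < T := by linarith
  have hf : ∀ n, |residueClass a n| ≤ vonMangoldt n + 1 := fun n => by
    rw [abs_of_nonneg (residueClass_nonneg a n)]
    linarith [residueClass_le a n]
  have hs := summable_mul_rpow_mul_fejer hf hT y
  refine hs.tsum_le_of_sum_le fun s => ?_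
  rw [← sum_filter_add_sum_filter_not s (· ∈ S)]
  refine add_le_add ?_ ?_
  · refine le_trans (sum_le_sum fun n _ => ?_) (sum_le_sum_of_subset_of_nonneg
      (fun n hn => (mem_filter.1 hn).2) fun n _ _ => ?_)
    · rw [Real.rpow_neg_one, ← div_eq_mul_inv]
      have := residueClass_nonneg a n
      exact mul_le_mul_of_nonneg_left (fejer_le hT0 _) (by positivity)
    · have := residueClass_nonneg a n
      positivity
  · have h1 : ∀ n ∈ s.filter (· ∉ S), residueClass a n * (n : ℝ) ^ (-1 : ℝ) *
        (T * Real.sinc (T * (Real.log n - y) / 2) ^ 2) ≤ 5 * (1 + (δ ^ 2)⁻¹) / T *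
        ((vonMangoldt n + 1) / n * (1 + (Real.log n - y) ^ 2)⁻¹) := by
      intro n hn
      have hn' := (mem_filter.1 hn).2
      rcases eq_or_ne n 0 with rfl | hn0
      · simp
      have hu := hS n hn' hn0
      set u := Real.log n - y
      have hu2 : δ ^ 2 ≤ u ^ 2 := by rw [← sq_abs u]; gcongr
      have hupos : 0 < u ^ 2 := lt_of_lt_of_le (by positivity) hu2
      have h2 : 5 * T * (1 + (T * u) ^ 2)⁻¹ ≤ 5 * (1 + (δ ^ 2)⁻¹) / T * (1 + u ^ 2)⁻¹ := by
        have h3 : 1 ≤ u ^ 2 * (δ ^ 2)⁻¹ := by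
          rw [← div_eq_mul_inv, one_le_div (by positivity)]; exact hu2
        rw [← div_eq_mul_inv, ← div_eq_mul_inv, div_div,
          div_le_div_iff₀ (by positivity) (by positivity)]
        have h4 : 0 ≤ (δ ^ 2)⁻¹ := by positivity
        have h5 : 0 ≤ T ^ 2 * (u ^ 2 * (δ ^ 2)⁻¹ - 1) :=
          mul_nonneg (by positivity) (by linarith)
        nlinarith
      have h3 := residueClass_nonneg a n
      have h4 := residueClass_le a n
      rw [Real.rpow_neg_one]
      calc residueClass a n * (n : ℝ)⁻¹ * (T * Real.sinc (T * u / 2) ^ 2) ≤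
          ((vonMangoldt n + 1) * (n : ℝ)⁻¹) * (5 * (1 + (δ ^ 2)⁻¹) / T * (1 + u ^ 2)⁻¹) := by
            refine mul_le_mul ?_ ((fejer_le hT0 u).trans h2) (by positivity) (by positivity)
            gcongr
            linarith
        _ = _ := by ring
    refine (sum_le_sum h1).trans ?_
    rw [← mul_sum]
    calc _ ≤ 5 * (1 + (δ ^ 2)⁻¹) / T * 1000 := by
          gcongr
          exact sum_vonMangoldt_add_one_div_le _ y
      _ = _ := by ring

open ArithmeticFunction vonMangoldt in
theorem eventually_le_sum_residueClass_div {q : ℕ} [NeZero q] {a : ZMod q} (ha : IsUnit a)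
    {δ : ℝ} (hδ : 0 < δ) : ∀ᶠ y : ℝ in atTop, ∀ S : Finset ℕ,
      (∀ n : ℕ, n ≠ 0 → y - δ ≤ Real.log n → Real.log n ≤ y + 2 * δ → n ∈ S) →
      δ * (q.totient : ℝ)⁻¹ / 3840 ≤ ∑ n ∈ S, residueClass a n / n := by
  set A : ℝ := (q.totient : ℝ)⁻¹ with hA
  have hφ : 0 < q.totient := Nat.totient_pos.2 (NeZero.pos q)
  have hA0 : 0 < A := by positivity
  set T : ℝ := max 1 (5000 * (1 + (δ ^ 2)⁻¹) * 64 / A) with hTdef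
  have hT : 1 ≤ T := le_max_left _ _
  have hT0 : 0 < T := by linarith
  have hT2 : 5000 * (1 + (δ ^ 2)⁻¹) / T ≤ A / 64 := by
    have h1 : 5000 * (1 + (δ ^ 2)⁻¹) * 64 / A ≤ T := le_max_right _ _
    rw [div_le_iff₀ hA0] at h1
    rw [div_le_div_iff₀ hT0 (by norm_num)]
    linarith
  obtain ⟨Y, hY⟩ := eventually_atTop.1 (eventually_le_tsum_residueClass_mul_fejer ha hT)
  filter_upwards [eventually_ge_atTop Y] with y hy S hS
  set J := ⌈T * δ⌉₊ with hJ
  have h1 : ∀ i ∈ range J, A / 64 ≤ ∑ n ∈ S, residueClass a n / n *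
      (5 * T * (1 + ((i : ℝ) - T * (Real.log n - y)) ^ 2)⁻¹) := by
    intro i hi
    have hiT : (i : ℝ) / T < δ := by
      rw [div_lt_iff₀ hT0, mul_comm]
      exact Nat.lt_ceil.1 (mem_range.1 hi)
    have hi0 : 0 ≤ (i : ℝ) / T := by positivity
    have h2 := hY (y + i / T) (by linarith)
    have h3 := tsum_residueClass_mul_fejer_le a hT hδ (y + i / T) S (fun n hn hn0 => by
      by_contra! hlt
      rw [abs_lt] at hlt
      exact hn (hS n hn0 (by linarith) (by linarith)))
    have h4 : ∀ n : ℕ, (T * (Real.log n - (y + i / T))) ^ 2 =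
        ((i : ℝ) - T * (Real.log n - y)) ^ 2 := fun n => by
      field_simp
      ring
    simp_rw [h4] at h3
    linarith
  have h2 := card_nsmul_le_sum _ _ _ h1
  rw [card_range, nsmul_eq_mul, sum_comm] at h2
  have h3 : ∑ n ∈ S, ∑ i ∈ range J, residueClass a n / n *
      (5 * T * (1 + ((i : ℝ) - T * (Real.log n - y)) ^ 2)⁻¹) ≤
      ∑ n ∈ S, residueClass a n / n * (60 * T) := by
    refine sum_le_sum fun n _ => ?_
    rw [← mul_sum, ← mul_sum]
    have h4 := residueClass_nonneg a n
    have h5 := sum_inv_one_add_sq_le J (T * (Real.log n - y))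
    refine mul_le_mul_of_nonneg_left ?_ (by positivity)
    nlinarith
  rw [← sum_mul] at h3
  have h4 : T * δ ≤ J := Nat.le_ceil _
  have h5 : T * δ * (A / 64) ≤ J * (A / 64) := by gcongr
  have h6 : T * (δ * A / 3840) ≤ T * ∑ n ∈ S, residueClass a n / n := by linarith
  exact le_of_mul_le_mul_left h6 hT0

open ArithmeticFunction vonMangoldt in
/-- A lower bound of the correct order of magnitude for the number of primes in a residue class
lying in a short interval `[N, (1 + η) N]`. -/
theorem exists_card_primes_modEq_ge {η : ℝ} (hη : 0 < η) :
    ∃ c : ℝ, 0 < c ∧ ∀ (q : ℕ) [NeZero q] (a : ZMod q), IsUnit a → ∀ᶠ N : ℕ in atTop,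
      c * N / (q.totient * Real.log N) ≤
        #{p ∈ Icc N ⌊(1 + η) * N⌋₊ | Nat.Prime p ∧ ((p : ℕ) : ZMod q) = a} := by
  set δ : ℝ := Real.log (1 + η) / 3 with hδdef
  have hδ : 0 < δ := div_pos (Real.log_pos (by linarith)) (by norm_num)
  refine ⟨δ / 15360, by positivity, fun q _ a ha => ?_⟩
  set A : ℝ := (q.totient : ℝ)⁻¹ with hA
  have hφ : 0 < q.totient := Nat.totient_pos.2 (NeZero.pos q)
  have hA0 : 0 < A := by positivity
  have hlogtop : Tendsto (fun N : ℕ => Real.log N) atTop atTop :=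
    Real.tendsto_log_atTop.comp tendsto_natCast_atTop_atTop
  obtain ⟨s, hs⟩ := summable_iff_vanishing_norm.1 (summable_residueClass_non_primes_div a)
    (δ * A / 7680) (by positivity)
  filter_upwards [(tendsto_atTop_add_const_right _ δ hlogtop).eventually
    (eventually_le_sum_residueClass_div ha hδ), eventually_gt_atTop (s.sup id),
    eventually_ge_atTop 2, hlogtop.eventually_ge_atTop (3 * δ)] with N h1 hNs hN2 hNlog
  have hN0 : (0 : ℝ) < N := by exact_mod_cast (by lia : 0 < N)
  have hlogN : 0 < Real.log N := Real.log_pos (by exact_mod_cast hN2)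
  set S := Icc N ⌊(1 + η) * N⌋₊ with hS
  have h3δ : 3 * δ = Real.log (1 + η) := by rw [hδdef]; ring
  have hlogS : ∀ n ∈ S, Real.log n ≤ 2 * Real.log N := by
    intro n hn
    rw [hS, mem_Icc] at hn
    have hn0 : (0 : ℝ) < n := by exact_mod_cast (by lia : 0 < n)
    have h2 : (n : ℝ) ≤ (1 + η) * N := (Nat.le_floor_iff (by positivity)).1 hn.2
    have h3 := Real.log_le_log hn0 h2
    rw [Real.log_mul (by linarith) hN0.ne'] at h3
    linarith
  have h2 := h1 S (fun n hn0 hn1 hn2 => by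
    have hn0' : (0 : ℝ) < n := by positivity
    rw [add_sub_cancel_right] at hn1
    have h3 : (N : ℝ) ≤ n := (Real.log_le_log_iff hN0 hn0').1 hn1
    have h4 : (n : ℝ) ≤ (1 + η) * N := by
      rw [← Real.log_le_log_iff hn0' (by positivity), Real.log_mul (by linarith) hN0.ne']
      linarith
    exact mem_Icc.2 ⟨by exact_mod_cast h3, Nat.le_floor h4⟩)
  have h3 := hs S (disjoint_left.2 fun n hn hns => by
    have h4 := le_sup (f := id) hns
    have h5 := (mem_Icc.1 hn).1
    simp only [id] at h4
    lia)
  have h4 := (Real.le_norm_self _).trans_lt h3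
  have h5 : ∑ n ∈ S, residueClass a n / n =
      ∑ n ∈ S, (if n.Prime then 0 else residueClass a n) / n +
      ∑ n ∈ S, (if n.Prime ∧ (n : ZMod q) = a then vonMangoldt n / n else 0) := by
    rw [← sum_add_distrib]
    refine sum_congr rfl fun n _ => ?_
    by_cases hp : n.Prime <;> by_cases hna : (n : ZMod q) = a <;>
      simp [hp, hna, residueClass, Set.indicator]
  rw [← sum_filter] at h5
  have h6 : ∑ n ∈ S with Nat.Prime n ∧ ((n : ℕ) : ZMod q) = a, vonMangoldt n / n ≤
      #{p ∈ S | Nat.Prime p ∧ ((p : ℕ) : ZMod q) = a} • (2 * Real.log N / N) := by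
    refine sum_le_card_nsmul _ _ _ fun n hn => ?_
    have hn1 := (mem_filter.1 hn).1
    have h7 := hlogS n hn1
    have h8 : (N : ℝ) ≤ n := by exact_mod_cast (mem_Icc.1 hn1).1
    have h9 := vonMangoldt_le_log (n := n)
    exact div_le_div₀ (by positivity) (h9.trans h7) hN0 h8
  rw [nsmul_eq_mul] at h6
  set B : ℝ := (#{p ∈ S | Nat.Prime p ∧ ((p : ℕ) : ZMod q) = a} : ℝ)
  have h7 : δ * A / 7680 ≤ B * (2 * Real.log N / N) := by linarith
  rw [← mul_div_assoc, le_div_iff₀ hN0] at h7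
  rw [← div_div, div_le_iff₀ hlogN]
  have h8 : δ / 15360 * N / q.totient = δ * A / 7680 * N / 2 := by
    rw [hA]; ring
  rw [h8]
  linarith

theorem not_summable_inv_primes_modEq_one {m : ℕ} (hm : m ≠ 0) :
    ¬ Summable fun n : ℕ => if n.Prime ∧ n ≡ 1 [MOD m] then (n : ℝ)⁻¹ else 0 := by
  intro hsum
  set f : ℕ → ℝ := fun n => if n.Prime ∧ n ≡ 1 [MOD m] then (n : ℝ)⁻¹ else 0 with hf
  have hf0 : ∀ n, 0 ≤ f n := fun n => by
    simp only [hf]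
    positivity
  have : NeZero m := ⟨hm⟩
  obtain ⟨c, hc, h⟩ := exists_card_primes_modEq_ge (η := 1 / 2) (by norm_num)
  have h1 := (tendsto_pow_atTop_atTop_of_one_lt one_lt_two).eventually (h m 1 isUnit_one)
  set B : ℕ → Finset ℕ := fun k => Icc (2 ^ k) ⌊(1 + 1 / 2 : ℝ) * (2 ^ k : ℕ)⌋₊ with hB
  have hBlt : ∀ k n, n ∈ B k → 2 ^ k ≤ n ∧ (n : ℝ) ≤ 3 / 2 * 2 ^ k := fun k n hn => by
    rw [hB, mem_Icc] at hn
    refine ⟨hn.1, ?_⟩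
    have := (Nat.le_floor_iff (by positivity)).1 hn.2
    push_cast at this
    linarith
  have hdisj : ∀ k l, k < l → Disjoint (B k) (B l) := fun k l hkl => by
    refine disjoint_left.2 fun n hn hn' => ?_
    have h2 := (hBlt k n hn).2
    have h3 : (2 : ℝ) ^ l ≤ n := by exact_mod_cast (hBlt l n hn').1
    have h4 : (2 : ℝ) ^ (k + 1) ≤ 2 ^ l := pow_le_pow_right₀ one_le_two hkl
    have h5 : (0 : ℝ) < 2 ^ k := by positivity
    rw [pow_succ] at h4
    linarith
  have hg : Summable fun k => ∑ n ∈ B k, f n := by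
    refine summable_of_sum_range_le (c := ∑' n, f n)
      (fun k => sum_nonneg fun n _ => hf0 n) fun n => ?_
    rw [← sum_biUnion]
    · exact hsum.sum_le_tsum _ fun n _ => hf0 n
    · intro k _ l _ hkl
      rcases lt_or_gt_of_ne hkl with h' | h'
      · exact hdisj k l h'
      · exact (hdisj l k h').symm
  set C : ℝ := 2 / 3 * c / (m.totient * Real.log 2) with hC
  have hφ : 0 < m.totient := Nat.totient_pos.2 (NeZero.pos m)
  have hlog2 := Real.log_pos one_lt_two
  have hCpos : 0 < C := by positivity
  have hinv : Summable fun k : ℕ => C * (k : ℝ)⁻¹ := by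
    refine Summable.of_norm_bounded_eventually_nat hg ?_
    filter_upwards [h1, eventually_gt_atTop 0] with k hk hk0
    have hk0' : (0 : ℝ) < k := by exact_mod_cast hk0
    rw [Real.norm_of_nonneg (by positivity)]
    have h2 : #{p ∈ B k | Nat.Prime p ∧ ((p : ℕ) : ZMod m) = 1} • (3 / 2 * 2 ^ k : ℝ)⁻¹ ≤
        ∑ n ∈ B k with Nat.Prime n ∧ ((n : ℕ) : ZMod m) = 1, f n := by
      refine card_nsmul_le_sum _ _ _ fun n hn => ?_
      have hn' := mem_filter.1 hn
      have h3 : n ≡ 1 [MOD m] := by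
        rw [← ZMod.natCast_eq_natCast_iff, Nat.cast_one]; exact hn'.2.2
      have h4 := hBlt k n hn'.1
      simp only [hf]
      rw [if_pos ⟨hn'.2.1, h3⟩]
      exact inv_anti₀ (by exact_mod_cast hn'.2.1.pos) h4.2
    refine le_trans ?_ (h2.trans (sum_le_sum_of_subset_of_nonneg (filter_subset _ _)
      fun n _ _ => hf0 n))
    rw [nsmul_eq_mul]
    refine le_trans ?_ (mul_le_mul_of_nonneg_right hk (by positivity))
    rw [hC]
    push_cast
    rw [Real.log_pow]
    refine le_of_eq ?_
    field_simp
  exact Real.not_summable_natCast_inv ((summable_mul_left_iff hCpos.ne').1 hinv)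

theorem exists_finset_sum_mem_Icc {f : ℕ → ℝ} (hf0 : ∀ n, 0 ≤ f n) (hf1 : ∀ n, f n ≤ 1)
    (hf : ¬ Summable f) (n₀ : ℕ) {B : ℝ} (hB : 0 ≤ B) :
    ∃ S : Finset ℕ, (∀ n ∈ S, n₀ ≤ n) ∧ B ≤ ∑ n ∈ S, f n ∧ ∑ n ∈ S, f n ≤ B + 1 := by
  have h1 : ¬ Summable fun n => f (n + n₀) := fun h => hf ((summable_nat_add_iff n₀).1 h)
  have h2 := (not_summable_iff_tendsto_nat_atTop_of_nonneg fun n => hf0 (n + n₀)).1 h1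
  have h3 : ∃ n, B ≤ ∑ i ∈ range n, f (i + n₀) := (h2.eventually_ge_atTop B).exists
  classical
  refine ⟨(range (Nat.find h3)).map (addRightEmbedding n₀), fun n hn => ?_, ?_, ?_⟩
  · obtain ⟨i, _, rfl⟩ := mem_map.1 hn
    exact Nat.le_add_left _ _
  · rw [sum_map]
    exact Nat.find_spec h3
  · rw [sum_map]
    rcases Nat.eq_zero_or_pos (Nat.find h3) with h0 | h0
    · rw [h0]; simp; linarith
    · obtain ⟨k, hk⟩ := Nat.exists_eq_succ_of_ne_zero h0.ne'
      have h4 := Nat.find_min h3 (m := k) (by lia)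
      rw [hk, Nat.succ_eq_add_one, sum_range_succ]
      have := hf1 (k + n₀)
      simp only [addRightEmbedding_apply]
      linarith

theorem exists_finset_primes_sum_inv {m : ℕ} (hm : m ≠ 0) (n₀ : ℕ) {B : ℝ} (hB : 0 ≤ B) :
    ∃ S : Finset ℕ, (∀ r ∈ S, n₀ ≤ r ∧ r.Prime ∧ r ≡ 1 [MOD m]) ∧
      B ≤ ∑ r ∈ S, (r : ℝ)⁻¹ ∧ ∑ r ∈ S, (r : ℝ)⁻¹ ≤ B + 1 := by
  obtain ⟨S, h1, h2, h3⟩ := exists_finset_sum_mem_Icc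
    (f := fun n : ℕ => if n.Prime ∧ n ≡ 1 [MOD m] then (n : ℝ)⁻¹ else 0)
    (fun n => by positivity) (fun n => by
      split_ifs with h
      · exact inv_le_one_of_one_le₀ (by exact_mod_cast h.1.one_lt.le)
      · exact zero_le_one) (not_summable_inv_primes_modEq_one hm) n₀ hB
  rw [← sum_filter] at h2 h3
  exact ⟨_, fun r hr => ⟨h1 r (mem_filter.1 hr).1, (mem_filter.1 hr).2⟩, h2, h3⟩

/-- A prime divisor of `(a ^ r - 1) / (a - 1)` has `a` as an element of order `r`, and is much
larger than `r` if `r - 1` is divisible by all small numbers. -/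
theorem exists_prime_orderOf_eq {a r L : ℕ} (ha : 2 ≤ a) (hr : r.Prime) (har : a < r)
    (hL : r ≡ 1 [MOD L.factorial]) :
    ∃ q : ℕ, q.Prime ∧ orderOf (a : ZMod q) = r ∧ r < q ∧ L * r < q := by
  have hx : ∑ i ∈ range r, a ^ i ≠ 1 := by
    have h1 : ∑ i ∈ range 2, a ^ i ≤ ∑ i ∈ range r, a ^ i :=
      sum_le_sum_of_subset (range_subset_range.2 hr.two_le)
    simp [sum_range_succ] at h1
    lia
  obtain ⟨q, hq, hqx⟩ := Nat.exists_prime_and_dvd hx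
  have : Fact q.Prime := ⟨hq⟩
  have h0 : (∑ i ∈ range r, (a : ZMod q) ^ i) = 0 := by
    have := (ZMod.natCast_eq_zero_iff _ _).2 hqx
    push_cast at this
    exact this
  have hpow : (a : ZMod q) ^ r = 1 := by
    have := geom_sum_mul (a : ZMod q) r
    rw [h0, zero_mul] at this
    exact (sub_eq_zero.1 this.symm)
  have hne : (a : ZMod q) ≠ 1 := by
    intro h
    rw [h] at h0
    simp only [one_pow, sum_const, card_range, nsmul_eq_mul, mul_one] at h0
    rw [ZMod.natCast_eq_zero_iff, Nat.prime_dvd_prime_iff_eq hq hr] at h0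
    subst h0
    rw [← Nat.cast_one, ZMod.natCast_eq_natCast_iff', Nat.mod_eq_of_lt har,
      Nat.mod_eq_of_lt hq.one_lt] at h
    lia
  have : Fact r.Prime := ⟨hr⟩
  have hord : orderOf (a : ZMod q) = r := orderOf_eq_prime hpow hne
  have ha0 : (a : ZMod q) ≠ 0 := by
    intro h
    rw [h, zero_pow hr.ne_zero] at hpow
    exact zero_ne_one hpow
  have hdvd : r ∣ q - 1 := hord ▸ ZMod.orderOf_dvd_card_sub_one ha0
  obtain ⟨d, hd⟩ := hdvd
  have hq1 := hq.two_le
  have hr2 := hr.two_le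
  have hqd : q = r * d + 1 := by lia
  have hd0 : d ≠ 0 := by
    rintro rfl
    lia
  have hrd : r ≤ r * d := Nat.le_mul_of_pos_right _ (Nat.pos_of_ne_zero hd0)
  refine ⟨q, hq, hord, by lia, ?_⟩
  by_contra! hlt
  have hdL : d + 1 ≤ L := by
    have : r * d < r * L := by lia
    exact Nat.lt_of_mul_lt_mul_left this
  have h1 : r ≡ 1 [MOD d + 1] := hL.of_dvd (Nat.dvd_factorial (by lia) hdL)
  have h2 : d + 1 ∣ q := by
    rw [← Nat.modEq_zero_iff_dvd, hqd]
    calc r * d + 1 ≡ 1 * d + 1 [MOD d + 1] := (h1.mul_right d).add_right 1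
      _ = d + 1 := by ring
      _ ≡ 0 [MOD d + 1] := by simp [Nat.ModEq]
  rcases (Nat.dvd_prime hq).1 h2 with h3 | h3
  · lia
  · have : 2 * d ≤ r * d := Nat.mul_le_mul_right _ hr2
    have h4 : r * d = d := by lia
    lia

theorem exists_modEq_dvd_mul_add {V b q k : ℕ} {c : ℤ} (hb : b.Coprime V) (hq : q.Prime)
    (hqV : ¬ q ∣ V) (hqk : ¬ q ∣ k) (hqc : ¬ (q : ℤ) ∣ c) :
    ∃ b' : ℕ, b' ≡ b [MOD V] ∧ b'.Coprime (V * q) ∧ (q : ℤ) ∣ k * b' + c := by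
  have : Fact q.Prime := ⟨hq⟩
  have hk0 : (k : ZMod q) ≠ 0 := by rwa [Ne, ZMod.natCast_eq_zero_iff]
  have hc0 : (c : ZMod q) ≠ 0 := by rwa [Ne, ZMod.intCast_zmod_eq_zero_iff_dvd]
  have hVq : V.Coprime q := ((Nat.Prime.coprime_iff_not_dvd hq).2 hqV).symm
  set x : ZMod q := -c / k with hx
  obtain ⟨b', h1, h2⟩ := Nat.chineseRemainder hVq b x.val
  have hbx : (b' : ZMod q) = x := by
    rw [(ZMod.natCast_eq_natCast_iff _ _ _).2 h2, ZMod.natCast_zmod_val]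
  refine ⟨b', h1, Nat.Coprime.mul_right ?_ ?_, ?_⟩
  · rw [Nat.Coprime, h1.gcd_eq]
    exact hb
  · refine ((Nat.Prime.coprime_iff_not_dvd hq).2 fun h => ?_).symm
    rw [← ZMod.natCast_eq_zero_iff, hbx, hx] at h
    exact div_ne_zero (neg_ne_zero.2 hc0) hk0 h
  · rw [← ZMod.intCast_zmod_eq_zero_iff_dvd]
    push_cast
    rw [hbx, hx]
    field_simp
    ring

theorem dvd_mul_add_of_modEq {W b b' q k : ℕ} {d : ℤ} (h : b' ≡ b [MOD W]) (hq : q ∣ W)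
    (hd : (q : ℤ) ∣ k * b + d) : (q : ℤ) ∣ k * b' + d := by
  have h1 : (b' : ℤ) ≡ b [ZMOD q] := Int.natCast_modEq_iff.2 (h.of_dvd hq)
  exact ((h1.mul_left k).add_right d).dvd_iff.2 hd

/-- One may enlarge the modulus `W` by primes `q` in which `a` has a prescribed prime order, at
negligible cost for `W / φ W`, so that `q ∣ k * b + c`. -/
theorem exists_modEq_forall_dvd {a k L W b : ℕ} {c : ℤ} (ha : 2 ≤ a) (hk : k ≠ 0) (hc : c ≠ 0)
    (hL : L ≠ 0) (hW : W ≠ 0) (hb : b.Coprime W) (S : Finset ℕ)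
    (hS : ∀ r ∈ S, (a < r ∧ k < r ∧ c.natAbs < r ∧ W < r) ∧ r.Prime ∧ r ≡ 1 [MOD L.factorial]) :
    ∃ W' b' : ℕ, W' ≠ 0 ∧ b'.Coprime W' ∧ W ∣ W' ∧ b' ≡ b [MOD W] ∧
      (W' / W'.totient : ℝ) ≤ W / W.totient * Real.exp (∑ r ∈ S, (r : ℝ)⁻¹ / L) ∧
      (∀ q : ℕ, q.Prime → q ∣ W' → q ∣ W ∨ orderOf (a : ZMod q) ∈ S) ∧
      ∀ r ∈ S, ∃ q : ℕ, q.Prime ∧ q ∣ W' ∧ (a : ZMod q) ^ r = 1 ∧ (q : ℤ) ∣ k * b' + c := by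
  induction S using Finset.induction_on with
  | empty => exact ⟨W, b, hW, hb, dvd_rfl, rfl, by simp, fun q _ h => .inl h, by simp⟩
  | insert r S hrS ih =>
    obtain ⟨V, d, hV, hd, hWV, hdb, hVφ, hVq, hVS⟩ :=
      ih fun s hs => hS s (mem_insert_of_mem hs)
    obtain ⟨⟨har, hkr, hcr, hWr⟩, hr, hrL⟩ := hS r (mem_insert_self _ _)
    obtain ⟨q, hq, hord, hrq, hLq⟩ := exists_prime_orderOf_eq ha hr har hrL
    have hqV : ¬ q ∣ V := fun h => by
      rcases hVq q hq h with h | h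
      · exact absurd (Nat.le_of_dvd (Nat.pos_of_ne_zero hW) h) (by lia)
      · exact hrS (hord ▸ h)
    have hqk : ¬ q ∣ k := fun h =>
      absurd (Nat.le_of_dvd (Nat.pos_of_ne_zero hk) h) (by lia)
    have hqc : ¬ (q : ℤ) ∣ c := fun h =>
      absurd (Nat.le_of_dvd (Int.natAbs_pos.2 hc) (Int.natCast_dvd.1 h)) (by lia)
    obtain ⟨b', hb'd, hb', hqb'⟩ := exists_modEq_dvd_mul_add hd hq hqV hqk hqc
    have hVq' : V.Coprime q := ((Nat.Prime.coprime_iff_not_dvd hq).2 hqV).symm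
    refine ⟨V * q, b', mul_ne_zero hV hq.ne_zero, hb', hWV.mul_right q, (hb'd.of_dvd hWV).trans hdb,
      ?_, fun l hl h => ?_, fun s hs => ?_⟩
    · rw [sum_insert hrS, add_comm, Real.exp_add, ← mul_assoc, Nat.totient_mul hVq',
        Nat.totient_prime hq]
      push_cast
      rw [mul_div_mul_comm]
      refine mul_le_mul hVφ ?_ (by positivity) (by positivity)
      have hr0 : (0 : ℝ) < r := by exact_mod_cast hr.pos
      have hL0 : (0 : ℝ) < L := by exact_mod_cast Nat.pos_of_ne_zero hL
      have h1 : (L * r : ℝ) ≤ ((q - 1 : ℕ) : ℝ) := by exact_mod_cast Nat.le_sub_one_of_lt hLq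
      have h2 : ((q - 1 : ℕ) : ℝ) = q - 1 := by rw [Nat.cast_sub hq.one_lt.le, Nat.cast_one]
      have h3 : (0 : ℝ) < L * r := by positivity
      rw [h2] at h1 ⊢
      calc (q / (q - 1) : ℝ) = 1 / (q - 1) + 1 := by
            have : (q - 1 : ℝ) ≠ 0 := by linarith
            field_simp
            ring
        _ ≤ 1 / (L * r) + 1 := by gcongr
        _ = (r : ℝ)⁻¹ / L + 1 := by field_simp
        _ ≤ _ := Real.add_one_le_exp _
    · rcases (Nat.Prime.dvd_mul hl).1 h with h | h
      · exact (hVq l hl h).imp_right (mem_insert_of_mem ·)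
      · rw [(Nat.prime_dvd_prime_iff_eq hl hq).1 h, hord]
        exact .inr (mem_insert_self _ _)
    · rcases mem_insert.1 hs with rfl | hs
      · exact ⟨q, hq, dvd_mul_left _ _, hord ▸ pow_orderOf_eq_one _, hqb'⟩
      · obtain ⟨l, hl, hlV, hla, hld⟩ := hVS s hs
        exact ⟨l, hl, hlV.mul_right q, hla, dvd_mul_add_of_modEq hb'd hlV hld⟩

theorem totient_prod_primes_le {S : Finset ℕ} (hS : ∀ r ∈ S, r.Prime) :
    ((∏ r ∈ S, r).totient : ℝ) ≤ Real.exp (-∑ r ∈ S, (r : ℝ)⁻¹) * (∏ r ∈ S, r : ℕ) := by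
  have h := Nat.totient_eq_mul_prod_factors (∏ r ∈ S, r)
  rw [Nat.primeFactors_prod hS] at h
  have h' : ((∏ r ∈ S, r).totient : ℝ) = (∏ r ∈ S, r : ℕ) * ∏ r ∈ S, (1 - (r : ℝ)⁻¹) := by
    have h1 := congrArg (Rat.cast : ℚ → ℝ) h
    push_cast at h1 ⊢
    exact h1
  rw [h', mul_comm, ← sum_neg_distrib, Real.exp_sum]
  refine mul_le_mul_of_nonneg_right (prod_le_prod (fun r hr => ?_) fun r hr => ?_) (by positivity)
  · exact sub_nonneg.2 (inv_le_one_of_one_le₀ (by exact_mod_cast (hS r hr).one_lt.le))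
  · exact Real.one_sub_le_exp_neg _

/-- There is a residue class `b` modulo `W`, with `W / φ W` bounded, such that for all the triples
`(a, k, c) ∈ T` and almost all `i`, every number `k * p + c * a ^ i` with `p ≡ b [MOD W]` has a
prime factor dividing `W`. -/
theorem exists_covering_residue {ε η : ℝ} (hε : 0 < ε) (hη : 0 < η) (T : Finset (ℕ × ℕ × ℤ))
    (hT : ∀ t ∈ T, 2 ≤ t.1 ∧ t.2.1 ≠ 0 ∧ t.2.2 ≠ 0) :
    ∃ W b : ℕ, W ≠ 0 ∧ b.Coprime W ∧ (W / W.totient : ℝ) ≤ Real.exp (η * #T) ∧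
      ∀ t ∈ T, ∃ R : ℕ, R ≠ 0 ∧ (R.totient : ℝ) ≤ ε * R ∧ ∀ i : ℕ, ¬ i.Coprime R →
        ∃ q : ℕ, q.Prime ∧ q ∣ W ∧ (q : ℤ) ∣ t.2.1 * b + t.2.2 * t.1 ^ i := by
  induction T using Finset.induction_on with
  | empty => exact ⟨1, 1, one_ne_zero, Nat.coprime_one_right 1, by simp, by simp⟩
  | insert t T htT ih =>
    obtain ⟨W, b, hW, hb, hWφ, hWT⟩ := ih fun s hs => hT s (mem_insert_of_mem hs)
    obtain ⟨a, k, c⟩ := t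
    obtain ⟨ha, hk, hc⟩ := hT _ (mem_insert_self _ _)
    set B : ℝ := max (-Real.log ε) 0 with hB
    have hB0 : 0 ≤ B := le_max_right _ _
    obtain ⟨L, hL⟩ := exists_nat_gt ((B + 1) / η)
    have hL0 : (0 : ℝ) < L := lt_of_le_of_lt (by positivity) hL
    obtain ⟨S, hS, hS1, hS2⟩ := exists_finset_primes_sum_inv (Nat.factorial_ne_zero L)
      (a + k + c.natAbs + W + 1) hB0
    obtain ⟨W', b', hW', hb', hWW', hbb', hWφ', -, hWS⟩ := exists_modEq_forall_dvd (L := L)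
      ha hk hc (by exact_mod_cast hL0.ne') hW hb S fun r hr =>
        ⟨by have := (hS r hr).1; lia, (hS r hr).2⟩
    refine ⟨W', b', hW', hb', hWφ'.trans ?_, fun s hs => ?_⟩
    · rw [card_insert_of_notMem htT, Nat.cast_add, Nat.cast_one, mul_add, mul_one, Real.exp_add]
      refine mul_le_mul hWφ (Real.exp_le_exp.2 ?_) (by positivity) (by positivity)
      rw [← sum_div]
      rw [div_lt_iff₀ hη] at hL
      rw [div_le_iff₀ hL0]
      linarith
    · rcases mem_insert.1 hs with rfl | hs
      · refine ⟨∏ r ∈ S, r, prod_ne_zero_iff.2 fun r hr => (hS r hr).2.1.ne_zero, ?_,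
          fun i hi => ?_⟩
        · refine (totient_prod_primes_le fun r hr => (hS r hr).2.1).trans ?_
          refine mul_le_mul_of_nonneg_right ?_ (by positivity)
          rw [← Real.le_log_iff_exp_le hε]
          have := le_max_left (-Real.log ε) 0
          linarith
        · have : ∃ r ∈ S, ¬ i.Coprime r := by
            by_contra! h
            exact hi (Nat.Coprime.prod_right h)
          obtain ⟨r, hrS, hir⟩ := this
          have hri : r ∣ i := by
            by_contra h
            exact hir ((Nat.Prime.coprime_iff_not_dvd (hS r hrS).2.1).2 h).symm
          obtain ⟨q, hq, hqW, hqa, hqb⟩ := hWS r hrS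
          refine ⟨q, hq, hqW, ?_⟩
          rw [← ZMod.intCast_zmod_eq_zero_iff_dvd] at hqb ⊢
          obtain ⟨d, rfl⟩ := hri
          push_cast at hqb ⊢
          rw [pow_mul, hqa, one_pow, mul_one, hqb]
      · obtain ⟨R, hR, hRφ, hRi⟩ := hWT s hs
        refine ⟨R, hR, hRφ, fun i hi => ?_⟩
        obtain ⟨q, hq, hqW, hqd⟩ := hRi i hi
        exact ⟨q, hq, hqW.trans hWW', dvd_mul_add_of_modEq hbb' hqW hqd⟩

theorem exists_forall_modEq_dvd {l W k r : ℕ} {h : ℤ} (hl : l.Prime) (hW : ¬ l ∣ W)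
    (hk : ¬ l ∣ k) (hh : ¬ (l : ℤ) ∣ h) :
    ∃ α β : ℕ, ¬ α ≡ β [MOD l] ∧ (∀ m : ℕ, m ≡ α [MOD l] → l ∣ W * m + r) ∧
      ∀ m : ℕ, m ≡ β [MOD l] → (l : ℤ) ∣ k * (W * m + r : ℕ) + h := by
  have : Fact l.Prime := ⟨hl⟩
  have hk0 : (k : ZMod l) ≠ 0 := by rwa [Ne, ZMod.natCast_eq_zero_iff]
  have hW0 : (W : ZMod l) ≠ 0 := by rwa [Ne, ZMod.natCast_eq_zero_iff]
  have hh0 : (h : ZMod l) ≠ 0 := by rwa [Ne, ZMod.intCast_zmod_eq_zero_iff_dvd]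
  refine ⟨(-r / W : ZMod l).val, ((-h / k - r) / W : ZMod l).val, fun hαβ => ?_,
    fun m hm => ?_, fun m hm => ?_⟩
  · rw [← ZMod.natCast_eq_natCast_iff, ZMod.natCast_zmod_val, ZMod.natCast_zmod_val] at hαβ
    field_simp at hαβ
    exact hh0 (by linear_combination hαβ)
  · rw [← ZMod.natCast_eq_natCast_iff, ZMod.natCast_zmod_val] at hm
    rw [← ZMod.natCast_eq_zero_iff]
    push_cast
    rw [hm]
    field_simp
    ring
  · rw [← ZMod.natCast_eq_natCast_iff, ZMod.natCast_zmod_val] at hm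
    rw [← ZMod.intCast_zmod_eq_zero_iff_dvd]
    push_cast
    rw [hm]
    field_simp
    ring

/-- Upper bound sieve for the primes `p ≡ b [MOD W]` such that `|k * p + h|` is also prime. -/
theorem card_prime_pairs_le {Q W b k : ℕ} {h : ℤ} (hQ : Q ≠ 0) (hQ2 : 2 ∣ Q) (hWQ : W ∣ Q)
    (hk : ∀ l : ℕ, l.Prime → ¬ l ∣ Q → ¬ l ∣ k)
    (hh : ∀ l : ℕ, l.Prime → ¬ l ∣ Q → ¬ (l : ℤ) ∣ h) {y : ℕ} (hy : 2 ≤ y) (X : ℕ) (A : Finset ℕ)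
    (hA : ∀ p ∈ A, p ≤ X ∧ p ≡ b [MOD W] ∧ p.Prime ∧ y ^ 2 < p ∧
      (k * p + h : ℤ).natAbs.Prime ∧ y ^ 2 < (k * p + h : ℤ).natAbs) :
    (#A : ℝ) ≤ (X / W + 1 : ℕ) * (Q / Q.totient : ℝ) ^ 2 / Real.log y ^ 2 + y ^ 12 := by
  have hαβ : ∀ l : ℕ, ∃ α β : ℕ, l.Prime → ¬ l ∣ Q → ¬ α ≡ β [MOD l] ∧
      (∀ m : ℕ, m ≡ α [MOD l] → l ∣ W * m + b % W) ∧
      ∀ m : ℕ, m ≡ β [MOD l] → (l : ℤ) ∣ k * (W * m + b % W : ℕ) + h := fun l => by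
    by_cases hl : l.Prime ∧ ¬ l ∣ Q
    · obtain ⟨α, β, H⟩ := exists_forall_modEq_dvd (r := b % W) hl.1
        (fun h => hl.2 (h.trans hWQ)) (hk l hl.1 hl.2) (hh l hl.1 hl.2)
      exact ⟨α, β, fun _ _ => H⟩
    · exact ⟨0, 0, fun h1 h2 => absurd ⟨h1, h2⟩ hl⟩
  choose α β H using hαβ
  have hdiv : ∀ p ∈ A, W * (p / W) + b % W = p := fun p hp => by
    rw [← show p % W = b % W from (hA p hp).2.1]
    exact Nat.div_add_mod p W
  have hinj : Set.InjOn (· / W) (A : Set ℕ) := fun p hp p' hp' hpp' => by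
    rw [← hdiv p hp, ← hdiv p' hp']
    simp only at hpp'
    rw [hpp']
  rw [← card_image_of_injOn hinj]
  refine card_le_of_avoid_two_classes hQ hQ2 hy _ α β (fun l hl hlQ => (H l hl hlQ).1) _
    (fun m hm => ?_) fun m hm l hl hly hlQ => ?_
  · obtain ⟨p, hp, rfl⟩ := mem_image.1 hm
    exact mem_range.2 (Nat.lt_succ_of_le (Nat.div_le_div_right (hA p hp).1))
  · obtain ⟨p, hp, rfl⟩ := mem_image.1 hm
    obtain ⟨-, -, hp1, hp2, hp3, hp4⟩ := hA p hp
    obtain ⟨-, H1, H2⟩ := H l hl hlQ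
    refine ⟨fun hm => ?_, fun hm => ?_⟩
    · have := H1 _ hm
      rw [hdiv p hp, Nat.prime_dvd_prime_iff_eq hl hp1] at this
      lia
    · have := H2 _ hm
      rw [hdiv p hp, Int.natCast_dvd, Nat.prime_dvd_prime_iff_eq hl hp3] at this
      lia

theorem card_filter_natAbs_le {k : ℕ} (hk : k ≠ 0) (h : ℤ) (z : ℕ) (G : Finset ℕ) :
    #{p ∈ G | (k * (p : ℕ) + h : ℤ).natAbs ≤ z} ≤ 2 * z + 1 := by
  have hinj : Function.Injective fun p : ℕ => (k * p + h : ℤ) := fun p p' hpp' => by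
    have hk' : (k : ℤ) ≠ 0 := by exact_mod_cast hk
    have := mul_left_cancel₀ hk' (add_right_cancel hpp')
    exact_mod_cast this
  rw [← card_image_of_injective _ hinj]
  refine (card_le_card (t := Icc (-z : ℤ) z) fun x hx => ?_).trans ?_
  · obtain ⟨p, hp, rfl⟩ := mem_image.1 hx
    have := (mem_filter.1 hp).2
    rw [mem_Icc]
    lia
  · rw [Int.card_Icc]
    lia

theorem card_filter_natAbs_prime_le {k : ℕ} (hk : k ≠ 0) (h : ℤ) (z : ℕ) (G : Finset ℕ) :
    #{p ∈ G | (k * (p : ℕ) + h : ℤ).natAbs.Prime} ≤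
      #{p ∈ G | (k * (p : ℕ) + h : ℤ).natAbs.Prime ∧ z < (k * (p : ℕ) + h : ℤ).natAbs} +
        (2 * z + 1) := by
  refine le_trans ?_ (Nat.add_le_add_left (card_filter_natAbs_le hk h z G) _)
  refine le_trans (card_le_card fun p hp => ?_) (card_union_le _ _)
  rw [mem_filter] at hp
  rw [mem_union, mem_filter, mem_filter]
  rcases le_or_gt (k * p + h : ℤ).natAbs z with h' | h'
  · exact .inr ⟨hp.1, h'⟩
  · exact .inl ⟨hp.1, hp.2, h'⟩

/-- Union bound over the exponents `i`, those not coprime to `R` contributing few primes. -/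
theorem card_exists_prime_le {G : Finset ℕ} {W b a k R z : ℕ} {c : ℤ} {ε S : ℝ} (hk : k ≠ 0)
    (hW : W ≠ 0) (hWz : W ≤ z) (hG : ∀ p ∈ G, p ≡ b [MOD W]) (hR : R ≠ 0)
    (hRε : (R.totient : ℝ) ≤ ε * R)
    (hcov : ∀ i : ℕ, ¬ i.Coprime R → ∃ q : ℕ, q.Prime ∧ q ∣ W ∧ (q : ℤ) ∣ k * b + c * a ^ i)
    (hS0 : 0 ≤ S) (hS : ∀ i : ℕ, (#{p ∈ G | (k * (p : ℕ) + c * a ^ i : ℤ).natAbs.Prime ∧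
      z < (k * (p : ℕ) + c * a ^ i : ℤ).natAbs} : ℝ) ≤ S) (n : ℕ) :
    (#{p ∈ G | ∃ i ∈ Icc 1 n, (k * (p : ℕ) + c * a ^ i : ℤ).natAbs.Prime} : ℝ) ≤
      (ε * n + R) * S + n * (2 * z + 1) := by
  have h1 : {p ∈ G | ∃ i ∈ Icc 1 n, (k * (p : ℕ) + c * a ^ i : ℤ).natAbs.Prime} ⊆
      (Icc 1 n).biUnion fun i => {p ∈ G | (k * (p : ℕ) + c * a ^ i : ℤ).natAbs.Prime} := fun p hp => by
    obtain ⟨hp, i, hi, hpi⟩ := mem_filter.1 hp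
    exact mem_biUnion.2 ⟨i, hi, mem_filter.2 ⟨hp, hpi⟩⟩
  have h2 : ∀ i ∈ Icc 1 n, (#{p ∈ G | (k * (p : ℕ) + c * a ^ i : ℤ).natAbs.Prime} : ℝ) ≤
      (if R.Coprime i then S else 0) + (2 * z + 1) := fun i _ => by
    split_ifs with hi
    · refine le_trans ?_ (add_le_add_left (hS i) _)
      exact_mod_cast card_filter_natAbs_prime_le hk (c * a ^ i) z G
    · rw [zero_add]
      refine le_trans ?_ (by exact_mod_cast card_filter_natAbs_le hk (c * a ^ i) z G :
        (#{p ∈ G | (k * (p : ℕ) + c * a ^ i : ℤ).natAbs ≤ z} : ℝ) ≤ 2 * z + 1)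
      rw [Nat.cast_le]
      refine card_le_card fun p hp => ?_
      rw [mem_filter] at hp ⊢
      obtain ⟨q, hq, hqW, hqd⟩ := hcov i fun h => hi h.symm
      have h4 := dvd_mul_add_of_modEq (hG p hp.1) hqW hqd
      rw [Int.natCast_dvd, Nat.prime_dvd_prime_iff_eq hq hp.2] at h4
      exact ⟨hp.1, h4 ▸ (Nat.le_of_dvd (Nat.pos_of_ne_zero hW) hqW).trans hWz⟩
  have h5 : (#{i ∈ Icc 1 n | R.Coprime i} : ℝ) ≤ ε * n + R := by
    have h6 := Nat.Ico_filter_coprime_le (a := R) 1 n hR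
    have h7 : Icc 1 n = Ico 1 (1 + n) := by ext; simp; lia
    rw [← h7] at h6
    have hR' : (0 : ℝ) < R := by exact_mod_cast Nat.pos_of_ne_zero hR
    calc (#{i ∈ Icc 1 n | R.Coprime i} : ℝ) ≤ (R.totient * (n / R + 1) : ℕ) := by
          exact_mod_cast h6
      _ ≤ R.totient * (n / R + 1 : ℝ) := by
          push_cast
          gcongr
          exact Nat.cast_div_le
      _ = R.totient * (n / R : ℝ) + R.totient := by ring
      _ ≤ ε * R * (n / R : ℝ) + R := by
          gcongr
          exact_mod_cast Nat.totient_le R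
      _ = ε * n + R := by field_simp
  calc _ ≤ ∑ i ∈ Icc 1 n, (#{p ∈ G | (k * (p : ℕ) + c * a ^ i : ℤ).natAbs.Prime} : ℝ) := by
        exact_mod_cast (card_le_card h1).trans card_biUnion_le
    _ ≤ ∑ i ∈ Icc 1 n, ((if R.Coprime i then S else 0) + (2 * z + 1)) := sum_le_sum h2
    _ = #{i ∈ Icc 1 n | R.Coprime i} * S + n * (2 * z + 1) := by
        rw [sum_add_distrib, ← sum_filter, sum_const, sum_const, nsmul_eq_mul, nsmul_eq_mul,
          Nat.card_Icc, Nat.add_sub_cancel]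
    _ ≤ _ := by gcongr

theorem div_totient_mul_le {m n : ℕ} (hm : m ≠ 0) (hn : n ≠ 0) :
    ((m * n : ℕ) / (m * n).totient : ℝ) ≤ m / m.totient * (n / n.totient) := by
  have h1 : (0 : ℝ) < m.totient := by exact_mod_cast Nat.totient_pos.2 (Nat.pos_of_ne_zero hm)
  have h2 : (0 : ℝ) < n.totient := by exact_mod_cast Nat.totient_pos.2 (Nat.pos_of_ne_zero hn)
  have h3 : (m.totient * n.totient : ℝ) ≤ (m * n).totient := by
    exact_mod_cast Nat.totient_super_multiplicative m n
  rw [div_mul_div_comm, Nat.cast_mul]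
  gcongr

theorem exists_pow_le_lt_pow {r : ℕ} (hr : r ≠ 0) (N : ℕ) : ∃ y : ℕ, y ^ r ≤ N ∧ N < (y + 1) ^ r := by
  have h : ∃ y : ℕ, N < (y + 1) ^ r := ⟨N, (Nat.lt_succ_self N).trans_le (Nat.le_self_pow hr _)⟩
  refine ⟨Nat.find h, ?_, Nat.find_spec h⟩
  rcases Nat.eq_zero_or_pos (Nat.find h) with h0 | h0
  · rw [h0, zero_pow hr]
    exact Nat.zero_le _
  · obtain ⟨k, hk⟩ := Nat.exists_eq_succ_of_ne_zero h0.ne'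
    rw [hk]
    exact not_lt.1 (Nat.find_min h (m := k) (by lia))

theorem eventually_sqrt_mul_log_pow_le : ∀ᶠ N : ℕ in atTop, √N * Real.log N ^ 3 ≤ N := by
  have h := ((isLittleO_log_rpow_atTop (r := 1 / 6) (by norm_num)).bound
    one_pos).natCast_atTop
  filter_upwards [h, eventually_ge_atTop 1] with N hN hN1
  have hN1' : (1 : ℝ) ≤ N := by exact_mod_cast hN1
  have h0 := Real.log_nonneg hN1'
  rw [Real.norm_of_nonneg h0, Real.norm_of_nonneg (by positivity), one_mul] at hN
  calc √N * Real.log N ^ 3 ≤ √N * ((N : ℝ) ^ (1 / 6 : ℝ)) ^ 3 := by gcongr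
    _ = √N * √N := by
        rw [← Real.rpow_natCast, ← Real.rpow_mul (by positivity), Real.sqrt_eq_rpow]
        norm_num
    _ = N := Real.mul_self_sqrt (by positivity)

theorem sieve_bound_le {W φ D q N x l e M Y s : ℝ} (hW : 0 < W) (hφ : 0 < φ) (he : 0 ≤ e)
    (hD : 0 ≤ D) (hN : 0 ≤ N) (hWφ : W / φ ≤ e) (hq : 0 ≤ q) (hqD : q ≤ W / φ * D) 
    (hM : M ≤ 2 * N / W + 1) (hx : 1 ≤ x) (hl : x ≤ 48 * l) (hs : 1 ≤ s) (hY : Y ≤ s) :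
    M * q ^ 2 / l ^ 2 + Y ≤
      4608 * e * D ^ 2 * N / (φ * x ^ 2) + (2304 * (e * D) ^ 2 + 1) * s := by
  have hx0 : 0 < x := by linarith
  have hl0 : 0 < l := by linarith
  have h1 : 1 / l ^ 2 ≤ 2304 / x ^ 2 := by
    rw [div_le_div_iff₀ (by positivity) (by positivity), one_mul]
    calc x ^ 2 ≤ (48 * l) ^ 2 := by gcongr
      _ = 2304 * l ^ 2 := by ring
  have h2 : M * q ^ 2 ≤ 2 * N * e * D ^ 2 / φ + (e * D) ^ 2 := by
    calc M * q ^ 2 ≤ (2 * N / W + 1) * (W / φ * D) ^ 2 := by gcongr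
      _ = 2 * N / φ * (W / φ) * D ^ 2 + (W / φ * D) ^ 2 := by field_simp
      _ ≤ 2 * N / φ * e * D ^ 2 + (e * D) ^ 2 := by gcongr
      _ = _ := by ring
  have h3 : 2304 / x ^ 2 ≤ 2304 * s := by
    rw [div_le_iff₀ (by positivity)]
    have : 1 ≤ s * x ^ 2 := one_le_mul_of_one_le_of_one_le hs (one_le_pow₀ hx)
    linarith
  calc M * q ^ 2 / l ^ 2 + Y = M * q ^ 2 * (1 / l ^ 2) + Y := by ring
    _ ≤ (2 * N * e * D ^ 2 / φ + (e * D) ^ 2) * (2304 / x ^ 2) + s := by gcongr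
    _ = 4608 * e * D ^ 2 * N / (φ * x ^ 2) + (e * D) ^ 2 * (2304 / x ^ 2) + s := by
        field_simp
        ring
    _ ≤ 4608 * e * D ^ 2 * N / (φ * x ^ 2) + (e * D) ^ 2 * (2304 * s) + s := by gcongr
    _ = _ := by ring

theorem union_bound_le {T ε K E C R c φ N x s n S z : ℝ}
    (hT : 0 ≤ T) (hε : 0 ≤ ε) (hK : 0 ≤ K) (hC : 0 ≤ C) (hR : 0 ≤ R)
    (hc : 0 < c) (hφ : 0 < φ) (hN : 0 ≤ N) (hx : 1 ≤ x)
    (hs : 0 ≤ s) (hn : n ≤ K * x) (hS0 : 0 ≤ S) (hS : S ≤ E * N / (φ * x ^ 2) + C * s)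
    (hz0 : 0 ≤ z) (hz : z ≤ 3 * s) (hsx : s * x ^ 3 ≤ N) (hεc : T * (ε * K * E) ≤ c / 4)
    (hA : 4 * φ / c * (T * (R * E / φ + ε * K * C + R * C + 3 * K)) ≤ x) :
    T * ((ε * n + R) * S + n * z) ≤ c / 2 * N / (φ * x) := by
  have hx0 : 0 < x := by linarith
  have h1 : x * s ≤ N / x ^ 2 := by
    rw [le_div_iff₀ (by positivity)]
    linarith
  have h2 : s ≤ N / x ^ 2 := le_trans (le_mul_of_one_le_left hs hx) h1
  set A := T * (R * E / φ + ε * K * C + R * C + 3 * K) with hA'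
  have h3 : A ≤ c / (4 * φ) * x := by
    rw [div_mul_eq_mul_div, div_le_iff₀ hc] at hA
    rw [div_mul_eq_mul_div, le_div_iff₀ (by positivity)]
    linarith
  calc T * ((ε * n + R) * S + n * z)
      ≤ T * ((ε * (K * x) + R) * (E * N / (φ * x ^ 2) + C * s) + K * x * (3 * s)) := by gcongr
    _ = T * (ε * K * E) * (N / (φ * x)) + T * (R * E / φ * (N / x ^ 2) + ε * K * C * (x * s) +
          R * C * s + 3 * K * (x * s)) := by
        field_simp
        ring
    _ ≤ c / 4 * (N / (φ * x)) + T * (R * E / φ * (N / x ^ 2) + ε * K * C * (N / x ^ 2) +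
          R * C * (N / x ^ 2) + 3 * K * (N / x ^ 2)) := by gcongr
    _ = c / 4 * (N / (φ * x)) + A * (N / x ^ 2) := by
        rw [hA']
        ring
    _ ≤ c / 4 * (N / (φ * x)) + c / (4 * φ) * x * (N / x ^ 2) := by gcongr
    _ = _ := by
        field_simp
        ring

theorem eventually_exists_root (y₀ : ℕ) : ∀ᶠ N : ℕ in atTop, ∃ y : ℕ, y₀ ≤ y ∧ y ^ 2 < N ∧
    (y : ℝ) ^ 12 ≤ √N ∧ Real.log N ≤ 48 * Real.log y := by
  filter_upwards [eventually_ge_atTop ((max y₀ 2 + 1) ^ 24)] with N hN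
  obtain ⟨y, hyN, hNy⟩ := exists_pow_le_lt_pow (r := 24) (by norm_num) N
  have hy := lt_of_pow_lt_pow_left₀ 24 (Nat.zero_le _) (hN.trans_lt hNy)
  have hy2 : 2 ≤ y := (le_max_right y₀ 2).trans (by lia)
  have hyy : y + 1 ≤ y ^ 2 := by
    have := Nat.mul_le_mul_right y hy2
    rw [sq]
    lia
  have hyN' : y ^ 2 < N := (Nat.pow_lt_pow_right (by lia) (by norm_num)).trans_le hyN
  refine ⟨y, (le_max_left y₀ 2).trans (by lia), hyN', Real.le_sqrt_of_sq_le ?_, ?_⟩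
  · rw [← pow_mul]
    exact_mod_cast hyN
  · have h1 : N ≤ y ^ 48 := by
      calc N ≤ (y + 1) ^ 24 := hNy.le
        _ ≤ (y ^ 2) ^ 24 := Nat.pow_le_pow_left hyy _
        _ = y ^ 48 := by rw [← pow_mul]
    have h2 : Real.log N ≤ Real.log ((y : ℝ) ^ 48) :=
      Real.log_le_log (by exact_mod_cast (Nat.zero_le _).trans_lt hyN') (by exact_mod_cast h1)
    rw [Real.log_pow] at h2
    exact_mod_cast h2

theorem not_dvd_of_not_dvd_factorial {l n m : ℕ} (h : ¬ l ∣ n.factorial) (hm : m ≠ 0)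
    (hmn : m ≤ n) : ¬ l ∣ m := fun h' => h (h'.trans (Nat.dvd_factorial (Nat.pos_of_ne_zero hm) hmn))

set_option maxHeartbeats 2000000 in
/-- There are many primes `p ∈ [N, (1 + 1 / K) * N]` for which all the numbers
`|k * p + c * a ^ i|` are composite. -/
theorem exists_card_primes_forall_not_prime_ge {K : ℕ} (hK : 1 ≤ K) :
    ∃ c : ℝ, 0 < c ∧ ∀ᶠ N : ℕ in atTop, ∃ G : Finset ℕ,
      (∀ p ∈ G, p.Prime ∧ N ≤ p ∧ (p : ℝ) ≤ (1 + 1 / K) * N ∧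
        ∀ a k : ℕ, 1 ≤ a → a ≤ K → 1 ≤ k → k ≤ K → ∀ c : ℤ, c ≠ 0 → c.natAbs ≤ K →
          ∀ i : ℕ, 1 ≤ i → (i : ℝ) ≤ K * Real.log N →
            ¬ (k * p + c * a ^ i : ℤ).natAbs.Prime) ∧
      c * N / Real.log N ≤ #G := by
  classical
  have hK0 : (0 : ℝ) < K := by exact_mod_cast hK
  obtain ⟨c, hc, hP⟩ := exists_card_primes_modEq_ge (η := 1 / K) (by positivity)
  set F : ℕ := (K + 2).factorial with hF
  have hF0 : F ≠ 0 := Nat.factorial_ne_zero _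
  have hFφ : (0 : ℝ) < F.totient := by
    exact_mod_cast Nat.totient_pos.2 (Nat.pos_of_ne_zero hF0)
  set D : ℝ := F / F.totient with hD
  have hD0 : 0 < D := by
    have : (0 : ℝ) < F := by exact_mod_cast Nat.pos_of_ne_zero hF0
    positivity
  set e : ℝ := Real.exp 1 with he
  have he0 : 0 < e := Real.exp_pos 1
  set E : ℝ := 4608 * e * D ^ 2 with hE
  have hE0 : 0 < E := by positivity
  set C : ℝ := 2304 * (e * D) ^ 2 + 1 with hC
  have hC0 : 0 < C := by positivity
  set T : Finset (ℕ × ℕ × ℤ) := Icc 1 K ×ˢ Icc 1 K ×ˢ {c ∈ Icc (-K : ℤ) K | c ≠ 0} with hT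
  have hTmem : ∀ t ∈ T, 1 ≤ t.1 ∧ t.1 ≤ K ∧ 1 ≤ t.2.1 ∧ t.2.1 ≤ K ∧ t.2.2 ≠ 0 ∧
      t.2.2.natAbs ≤ K := fun t ht => by
    simp only [hT, mem_product, mem_Icc, mem_filter] at ht
    lia
  set ε : ℝ := c / (4 * (#T + 1) * K * E) with hε
  have hε0 : 0 < ε := by positivity
  have hεc : #T * (ε * K * E) ≤ c / 4 := by
    have h1 : (#T + 1) * (ε * K * E) = c / 4 := by
      rw [hε]
      field_simp
    have : 0 ≤ ε * K * E := by positivity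
    linarith
  obtain ⟨W, b, hW, hb, hWe, hcov⟩ := exists_covering_residue hε0
    (η := 1 / (#T + 1)) (by positivity) {t ∈ T | 2 ≤ t.1} fun t ht => by
      have := hTmem t (mem_filter.1 ht).1
      have := (mem_filter.1 ht).2
      lia
  have : NeZero W := ⟨hW⟩
  have hW0 : (0 : ℝ) < W := by exact_mod_cast Nat.pos_of_ne_zero hW
  have hφ0 : (0 : ℝ) < W.totient := by
    exact_mod_cast Nat.totient_pos.2 (Nat.pos_of_ne_zero hW)
  have hWφ : (W / W.totient : ℝ) ≤ e := by
    refine hWe.trans (Real.exp_le_exp.2 ?_)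
    rw [div_mul_eq_mul_div, one_mul, div_le_one (by positivity)]
    have : (#{t ∈ T | 2 ≤ t.1} : ℝ) ≤ #T := by exact_mod_cast card_filter_le _ _
    linarith
  choose! R hR0 hRε hRcov using hcov
  set R₀ : ℕ := 1 + ∑ t ∈ T, R t with hR₀
  have hRle : ∀ t ∈ T, R t ≤ R₀ := fun t ht =>
    (single_le_sum (f := R) (fun _ _ => Nat.zero_le _) ht).trans (Nat.le_add_left _ _)
  set A : ℝ := 4 * W.totient / c *
    (#T * (R₀ * E / W.totient + ε * K * C + R₀ * C + 3 * K)) with hA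
  refine ⟨c / (2 * W.totient), by positivity, ?_⟩
  have hlog := Real.tendsto_log_atTop.comp tendsto_natCast_atTop_atTop
  filter_upwards [hP W b ((ZMod.isUnit_iff_coprime b W).2 hb), eventually_sqrt_mul_log_pow_le,
    hlog.eventually_ge_atTop 1, hlog.eventually_ge_atTop A,
    eventually_exists_root (W + 2)] with N hG hsx hx hxA ⟨y, hWy, hyN', hys, hxy⟩
  simp only [Function.comp_apply] at hx hxA
  set x := Real.log N with hxdef
  have hy2 : 2 ≤ y := by lia
  have hWz : W ≤ y ^ 2 := (by lia : W ≤ y).trans (Nat.le_self_pow two_ne_zero y)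
  have hN0 : 0 < N := by lia
  set X : ℕ := ⌊(1 + 1 / K : ℝ) * N⌋₊ with hX
  set G : Finset ℕ := {p ∈ Icc N X | Nat.Prime p ∧ ((p : ℕ) : ZMod W) = b} with hGdef
  have hGmem : ∀ p ∈ G, N ≤ p ∧ p ≤ X ∧ p.Prime ∧ p ≡ b [MOD W] := fun p hp => by
    rw [hGdef, mem_filter, mem_Icc, ZMod.natCast_eq_natCast_iff] at hp
    tauto
  clear_value G
  set n : ℕ := ⌊K * x⌋₊ with hn
  have hnx : (n : ℝ) ≤ K * x := Nat.floor_le (by positivity)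
  have hn1 : 1 ≤ n := Nat.le_floor (by
    push_cast
    exact one_le_mul_of_one_le_of_one_le (by exact_mod_cast hK) hx)
  set Q : ℕ := W * F with hQ
  have hQ0 : Q ≠ 0 := mul_ne_zero hW hF0
  set S : ℝ := (X / W + 1 : ℕ) * (Q / Q.totient : ℝ) ^ 2 / Real.log y ^ 2 + y ^ 12 with hS
  have hS0 : 0 ≤ S := by positivity
  have hs1 : 1 ≤ √(N : ℝ) := Real.one_le_sqrt.2 (by exact_mod_cast hN0)
  have hz : (2 * (y ^ 2 : ℕ) + 1 : ℝ) ≤ 3 * √N := by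
    have : (y : ℝ) ^ 2 ≤ y ^ 12 :=
      pow_le_pow_right₀ (by exact_mod_cast (by lia : 1 ≤ y)) (by norm_num)
    push_cast
    linarith
  have hSle : S ≤ E * N / (W.totient * x ^ 2) + C * √N := by
    refine sieve_bound_le hW0 hφ0 he0.le hD0.le (by positivity) hWφ (by positivity)
      (div_totient_mul_le hW hF0) ?_ hx hxy hs1 hys
    · have h1 : ((X / W : ℕ) : ℝ) ≤ X / W := Nat.cast_div_le
      have h2 : (X : ℝ) ≤ 2 * N := by
        refine (Nat.floor_le (by positivity)).trans ?_
        have : (1 / K : ℝ) ≤ 1 := by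
          rw [div_le_one hK0]
          exact_mod_cast hK
        gcongr
        linarith
      push_cast
      have h3 : (X / W : ℝ) ≤ 2 * N / W := by gcongr
      linarith
  have hsieve : ∀ t ∈ T, ∀ i : ℕ, (#{p ∈ G | (t.2.1 * (p : ℕ) + t.2.2 * t.1 ^ i : ℤ).natAbs.Prime ∧
      y ^ 2 < (t.2.1 * (p : ℕ) + t.2.2 * t.1 ^ i : ℤ).natAbs} : ℝ) ≤ S := fun t ht i => by
    obtain ⟨ha1, haK, hk1, hkK, hc0, hcK⟩ := hTmem t ht
    have hlF : ∀ l : ℕ, ¬ l ∣ Q → ∀ m : ℕ, m ≠ 0 → m ≤ K → ¬ l ∣ m := fun l hl m hm hmK =>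
      not_dvd_of_not_dvd_factorial (fun h => hl (h.mul_left W)) hm (hmK.trans (Nat.le_add_right K 2))
    refine card_prime_pairs_le (W := W) (b := b) (k := t.2.1) (h := t.2.2 * t.1 ^ i) hQ0
      ((Nat.dvd_factorial two_pos (by lia)).mul_left W) (dvd_mul_right _ _)
      (fun l _ hl => hlF l hl _ (by lia) hkK) (fun l hl hlQ h => ?_) hy2 X _ fun p hp => ?_
    · rcases (Nat.prime_iff_prime_int.1 hl).dvd_or_dvd h with h | h
      · exact hlF l hlQ _ (Int.natAbs_ne_zero.2 hc0) hcK (Int.natCast_dvd.1 h)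
      · have := (Nat.prime_iff_prime_int.1 hl).dvd_of_dvd_pow h
        exact hlF l hlQ t.1 (by lia) haK (by exact_mod_cast this)
    · obtain ⟨hpG, hp1, hp2⟩ := mem_filter.1 hp
      obtain ⟨hp3, hp4, hp5, hp6⟩ := hGmem p hpG
      exact ⟨hp4, hp6, hp5, by lia, hp1, hp2⟩
  set P : ℕ × ℕ × ℤ → Finset ℕ := fun t =>
    {p ∈ G | ∃ i ∈ Icc 1 n, (t.2.1 * (p : ℕ) + t.2.2 * t.1 ^ i : ℤ).natAbs.Prime} with hPdef
  have hPle : ∀ t ∈ T, (#(P t) : ℝ) ≤ (ε * n + R₀) * S + n * (2 * (y ^ 2 : ℕ) + 1) := fun t ht => by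
    obtain ⟨ha1, haK, hk1, hkK, hc0, hcK⟩ := hTmem t ht
    rcases Nat.lt_or_ge t.1 2 with ha | ha
    · have ha' : t.1 = 1 := by lia
      have hR₀1 : (1 : ℝ) ≤ R₀ := by
        rw [hR₀]
        exact_mod_cast Nat.le_add_right 1 _
      have h1 : P t ⊆ {p ∈ G | (t.2.1 * (p : ℕ) + t.2.2 * t.1 ^ 0 : ℤ).natAbs.Prime} :=
        fun p hp => by
          obtain ⟨hp, i, -, hpi⟩ := mem_filter.1 hp
          rw [ha', Nat.cast_one, one_pow] at hpi
          rw [mem_filter, pow_zero]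
          exact ⟨hp, hpi⟩
      have h2 : (#(P t) : ℝ) ≤ S + (2 * (y ^ 2 : ℕ) + 1) := by
        have h3 := (card_le_card h1).trans
          (card_filter_natAbs_prime_le (Nat.pos_iff_ne_zero.1 hk1) _ (y ^ 2) G)
        refine le_trans (Nat.cast_le.2 h3) ?_
        rw [Nat.cast_add]
        refine add_le_add (hsieve t ht 0) (le_of_eq ?_)
        push_cast
        rfl
      refine h2.trans (add_le_add (le_mul_of_one_le_left hS0 ?_)
        (le_mul_of_one_le_left (by positivity) (by exact_mod_cast hn1)))
      have : 0 ≤ ε * n := by positivity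
      linarith
    · have ht' : t ∈ T.filter fun t => 2 ≤ t.1 := mem_filter.2 ⟨ht, ha⟩
      refine (card_exists_prime_le (by lia) hW hWz (fun p hp => (hGmem p hp).2.2.2) (hR0 t ht')
        (hRε t ht') (hRcov t ht') hS0 (hsieve t ht) n).trans ?_
      have : (R t : ℝ) ≤ R₀ := by exact_mod_cast hRle t ht
      gcongr
  have hbad : (#(T.biUnion P) : ℝ) ≤ c / 2 * N / (W.totient * x) := by
    calc (#(T.biUnion P) : ℝ) ≤ ∑ t ∈ T, (#(P t) : ℝ) := by exact_mod_cast card_biUnion_le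
      _ ≤ #T * ((ε * n + R₀) * S + n * (2 * (y ^ 2 : ℕ) + 1)) := by
          rw [← nsmul_eq_mul]
          exact sum_le_card_nsmul _ _ _ hPle
      _ ≤ _ := union_bound_le (by positivity) hε0.le hK0.le hC0.le (by positivity) hc hφ0
          (by positivity) hx (by positivity) hnx hS0 hSle (by positivity) hz hsx hεc hxA
  refine ⟨G \ T.biUnion P, fun p hp => ?_, ?_⟩
  · obtain ⟨hpG, hpP⟩ := mem_sdiff.1 hp
    obtain ⟨hp1, hp2, hp3, -⟩ := hGmem p hpG
    refine ⟨hp3, hp1, (Nat.le_floor_iff (by positivity)).1 hp2,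
      fun a k ha1 haK hk1 hkK c hc0 hcK i hi1 hin hprime => hpP ?_⟩
    refine mem_biUnion.2 ⟨(a, k, c), ?_, mem_filter.2 ⟨hpG, i, mem_Icc.2 ⟨hi1, Nat.le_floor hin⟩,
      hprime⟩⟩
    simp only [hT, mem_product, mem_Icc, mem_filter]
    lia
  · have h1 : (#G : ℝ) ≤ #(G \ T.biUnion P) + #(T.biUnion P) := by
      exact_mod_cast card_le_card_sdiff_add_card
    have h2 : c * N / (W.totient * x) =
        c / (2 * W.totient) * N / x + c / 2 * N / (W.totient * x) := by
      field_simp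
      ring
    linarith

end

/-- Main theorem: for each `K ≥ 1` there is `c_K > 0` such that for all
sufficiently large `N`, at least `c_K · N / log N` primes `p ∈ [N, (1+1/K)N]`
have `|k·p ± j·a^i|` non-prime for all `1 ≤ a, j, k ≤ K` and `1 ≤ i ≤ K·log N`. -/
theorem stmt_13 (K : ℕ) (hK : 1 ≤ K) :
    ∃ c : ℝ, 0 < c ∧ ∃ N₀ : ℕ, ∀ N : ℕ, N₀ ≤ N →
      c * N / Real.log N ≤
        Nat.card {p : ℕ | p.Prime ∧ N ≤ p ∧ (p : ℝ) ≤ (1 + 1 / K) * N ∧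
          ∀ a j k : ℕ, 1 ≤ a → a ≤ K → 1 ≤ j → j ≤ K → 1 ≤ k → k ≤ K →
            ∀ i : ℕ, 1 ≤ i → (i : ℝ) ≤ K * Real.log N →
              ¬ ((k * p : ℤ) + j * a ^ i).natAbs.Prime ∧
              ¬ ((k * p : ℤ) - j * a ^ i).natAbs.Prime} := by
  obtain ⟨c, hc, h⟩ := exists_card_primes_forall_not_prime_ge hK
  obtain ⟨N₀, hN₀⟩ := Filter.eventually_atTop.1 h
  refine ⟨c, hc, N₀, fun N hN => ?_⟩
  obtain ⟨G, hG, hcard⟩ := hN₀ N hN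
  refine hcard.trans ?_
  rw [Nat.cast_le, ← Set.ncard_coe_finset G]
  refine Set.ncard_le_ncard (fun p hp => ?_) ?_
  · obtain ⟨h1, h2, h3, h4⟩ := hG p hp
    refine ⟨h1, h2, h3, fun a j k ha haK hj hjK hk hkK i hi hiK => ⟨?_, ?_⟩⟩
    · exact h4 a k ha haK hk hkK j (by lia) (by lia) i hi hiK
    · have := h4 a k ha haK hk hkK (-j) (by lia) (by lia) i hi hiK
      rwa [neg_mul, ← sub_eq_add_neg] at this
  · refine (Set.finite_Iic ⌊(1 + 1 / K : ℝ) * N⌋₊).subset fun p hp => ?_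
    exact Nat.le_floor hp.2.2.1
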